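/- arXiv:1910.04605 — 2 statements merged into one kernel-verified Lean document; each statement's English description precedes it below -/
import Mathlib

section
/- Fix a field F and integers d >= 1, k >= 1. Let K be a finite simplicial d-complex whose d-simplices support at least one nontrivial d-cycle over F. If f_d(K) > ((d+1)/2) * k(k+1) * rank_d(K), then K contains a simple d-cycle of size greater than k. -/
open Finset

/-- The simplicial boundary of a simplex `σ` (a finite set of vertices from a linearly
ordered vertex set), as an element of the free `F`-vector space on the set of all
simplices: if `σ = [v_0, …, v_d]` with `v_0 < ⋯ < v_d`, then
`∂σ = ∑ⱼ (-1)ʲ [v_0, …, v̂_j, …, v_d]`. -/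
noncomputable def sbdry (F : Type) [Field F] {V : Type} [LinearOrder V]
    (σ : Finset V) : (Finset V) →₀ F :=
  ∑ v ∈ σ, ((-1 : F) ^ ((σ.filter (fun w => w < v)).card)) •
    Finsupp.single (σ.erase v) (1 : F)

/-- `c` is a `d`-cycle over `F`: an `F`-linear combination of `d`-simplices
(i.e. `(d+1)`-element vertex sets) whose boundary is `0`. -/
def IsCycle (F : Type) [Field F] {V : Type} [LinearOrder V] (d : ℕ)
    (c : (Finset V) →₀ F) : Prop :=
  (∀ σ ∈ c.support, σ.card = d + 1) ∧ ∑ σ ∈ c.support, c σ • sbdry F σ = 0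

/-- A nontrivial `d`-cycle is simple if its support does not strictly contain the
support of any other nontrivial `d`-cycle. -/
def IsSimpleCycle (F : Type) [Field F] {V : Type} [LinearOrder V] (d : ℕ)
    (c : (Finset V) →₀ F) : Prop :=
  IsCycle F d c ∧ c ≠ 0 ∧
    ∀ c' : (Finset V) →₀ F, IsCycle F d c' → c' ≠ 0 → c'.support ⊆ c.support →
      c'.support = c.support

/-- The rank over `F` of a finite set `A` of `d`-simplices: the dimension of the span
of the boundaries of the members of `A`. -/
noncomputable def rankBd (F : Type) [Field F] {V : Type} [LinearOrder V]
    (A : Finset (Finset V)) : ℕ :=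
  Module.finrank F (Submodule.span F ((fun σ => sbdry F σ) '' (↑A : Set (Finset V))))


/-- `a` is a vector of minimal nonempty support in the subspace `R`. -/
def CircIn {F ι : Type} [Field F] (R : Submodule F (ι →₀ F)) (a : ι →₀ F) : Prop :=
  a ∈ R ∧ a ≠ 0 ∧ ∀ b ∈ R, b ≠ 0 → b.support ⊆ a.support → a.support ⊆ b.support

set_option linter.unusedSectionVars false

section Circ
variable {F ι : Type} [Field F] [DecidableEq ι]

/-- Subtract a multiple of `b` from `a` to kill the coordinate `g`. -/
noncomputable def killAt (a b : ι →₀ F) (g : ι) : ι →₀ F := a - (a g / b g) • b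

lemma killAt_self (a b : ι →₀ F) (g : ι) (h : b g ≠ 0) : killAt a b g g = 0 := by
  simp [killAt, h]

lemma killAt_mem {R : Submodule F (ι →₀ F)} {a b : ι →₀ F} (ha : a ∈ R) (hb : b ∈ R) (g : ι) :
    killAt a b g ∈ R := R.sub_mem ha (R.smul_mem _ hb)

lemma killAt_apply (a b : ι →₀ F) (g e : ι) :
    killAt a b g e = a e - (a g / b g) * b e := by
  simp [killAt]

lemma killAt_support (a b : ι →₀ F) (g : ι) (h : b g ≠ 0) :
    (killAt a b g).support ⊆ (a.support ∪ b.support).erase g := by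
  intro e he
  rw [Finsupp.mem_support_iff] at he
  have h1 : e ≠ g := by rintro rfl; exact he (killAt_self a b e h)
  rw [killAt_apply] at he
  simp only [mem_erase, mem_union, Finsupp.mem_support_iff]
  refine ⟨h1, ?_⟩
  by_contra! h2
  exact he (by rw [h2.1, h2.2]; simp)

lemma circ_unique {R : Submodule F (ι →₀ F)} {a b : ι →₀ F} (ha : CircIn R a) (hb : b ∈ R)
    (hs : b.support ⊆ a.support) : ∃ t : F, b = t • a := by
  obtain ⟨g, hg⟩ := Finsupp.support_nonempty_iff.2 ha.2.1
  have hg' : a g ≠ 0 := Finsupp.mem_support_iff.1 hg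
  refine ⟨b g / a g, ?_⟩
  have h1 := killAt_support b a g hg'
  by_contra hne
  have h2 : killAt b a g ≠ 0 := sub_ne_zero.2 hne
  have h3 := ha.2.2 _ (killAt_mem hb ha.1 g) h2
    (fun x hx => by have := h1 hx; simp only [mem_erase, mem_union] at this; exact this.2.elim (fun h => hs h) id)
  have := h1 (h3 hg)
  simp at this

lemma circ_of_subset_ssubset {R : Submodule F (ι →₀ F)} {a b : ι →₀ F} (ha : CircIn R a)
    (hb : b ∈ R) (hs : b.support ⊆ a.support) {g : ι} (hg : g ∈ a.support) (hg' : g ∉ b.support) :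
    b = 0 := by
  by_contra h
  exact hg' (ha.2.2 b hb h hs hg)

lemma exists_circ {R : Submodule F (ι →₀ F)} {a : ι →₀ F} (ha : a ∈ R) {e : ι}
    (he : e ∈ a.support) : ∃ c, CircIn R c ∧ c.support ⊆ a.support ∧ e ∈ c.support := by
  induction hn : a.support.card using Nat.strong_induction_on generalizing a with
  | _ n ih =>
    by_cases hc : CircIn R a
    · exact ⟨a, hc, subset_rfl, he⟩
    · have h0 : a ≠ 0 := by rintro rfl; simp at he
      simp only [CircIn, not_and, not_forall] at hc
      obtain ⟨b, hb, hb0, hbs, hns⟩ := hc ha h0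
      by_cases heb : e ∈ b.support
      · obtain ⟨c, hc1, hc2, hc3⟩ := ih _ (hn ▸ card_lt_card ⟨hbs, hns⟩) hb heb rfl
        exact ⟨c, hc1, hc2.trans hbs, hc3⟩
      · obtain ⟨g, hg⟩ := Finsupp.support_nonempty_iff.2 hb0
        have hk := killAt_support a b g (Finsupp.mem_support_iff.1 hg)
        rw [union_eq_left.2 hbs] at hk
        have hek : e ∈ (killAt a b g).support := by
          rw [Finsupp.mem_support_iff, killAt_apply, Finsupp.notMem_support_iff.1 heb]
          simpa using he
        obtain ⟨c, hc1, hc2, hc3⟩ := ih _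
          (hn ▸ (card_le_card hk).trans_lt (card_erase_lt_of_mem (hbs hg)))
          (killAt_mem ha hb g) hek rfl
        exact ⟨c, hc1, (hc2.trans hk).trans (erase_subset _ _), hc3⟩

/-- Two elements on intersecting circuits lie on a common circuit. -/
lemma circ_trans {R : Submodule F (ι →₀ F)} {a b : ι →₀ F} (ha : CircIn R a) (hb : CircIn R b)
    {e f g : ι} (he : e ∈ a.support) (hf : f ∈ b.support) (hga : g ∈ a.support)
    (hgb : g ∈ b.support) :
    ∃ c, CircIn R c ∧ c.support ⊆ a.support ∪ b.support ∧ e ∈ c.support ∧ f ∈ c.support := by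
  induction hn : (a.support ∪ b.support).card using Nat.strong_induction_on
    generalizing a b g with
  | _ n ih =>
    by_cases heb : e ∈ b.support
    · exact ⟨b, hb, subset_union_right, heb, hf⟩
    by_cases hfa : f ∈ a.support
    · exact ⟨a, ha, subset_union_left, he, hfa⟩
    have hgb0 := Finsupp.mem_support_iff.1 hgb
    have hga0 := Finsupp.mem_support_iff.1 hga
    have hk := killAt_support a b g hgb0
    have hkm := killAt_mem ha.1 hb.1 g
    have hek : e ∈ (killAt a b g).support := by
      rw [Finsupp.mem_support_iff, killAt_apply, Finsupp.notMem_support_iff.1 heb]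
      simpa using he
    have hfk : f ∈ (killAt a b g).support := by
      rw [Finsupp.mem_support_iff, killAt_apply, Finsupp.notMem_support_iff.1 hfa]
      simp only [zero_sub, neg_ne_zero]
      exact mul_ne_zero (div_ne_zero hga0 hgb0) (Finsupp.mem_support_iff.1 hf)
    obtain ⟨c, hc, hcs, hec⟩ := exists_circ hkm hek
    obtain ⟨c', hc', hcs', hfc⟩ := exists_circ hkm hfk
    have hcs1 := hcs.trans hk
    have hcs2 := hcs'.trans hk
    -- `c` meets `b`
    have hm1 : ∃ x ∈ c.support, x ∉ a.support := by
      by_contra! h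
      have := hcs1 (ha.2.2 c hc.1 hc.2.1 h hga)
      simp at this
    have hm2 : ∃ x ∈ c'.support, x ∉ b.support := by
      by_contra! h
      have := hcs2 (hb.2.2 c' hc'.1 hc'.2.1 h hgb)
      simp at this
    obtain ⟨x, hxc, hxa⟩ := hm1
    obtain ⟨y, hyc, hyb⟩ := hm2
    have hxb : x ∈ b.support := by have := hcs1 hxc; simp only [mem_erase, mem_union] at this; tauto
    have hya : y ∈ a.support := by have := hcs2 hyc; simp only [mem_erase, mem_union] at this; tauto
    have hsub : c.support ∪ b.support ⊆ a.support ∪ b.support :=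
      union_subset (hcs1.trans (erase_subset _ _)) subset_union_right
    by_cases hlt : c.support ∪ b.support ⊂ a.support ∪ b.support
    · obtain ⟨h, h1, h2, h3, h4⟩ := ih _ (hn ▸ card_lt_card hlt) hc hb hec hf hxc hxb rfl
      exact ⟨h, h1, h2.trans hsub, h3, h4⟩
    · have heq : a.support ∪ b.support ⊆ c.support ∪ b.support := by
        by_contra h; exact hlt ⟨hsub, h⟩
      have hyc' : y ∈ c.support := by
        have := heq (mem_union_left _ hya); simp only [mem_union] at this; tauto
      have hsub2 : c.support ∪ c'.support ⊆ (a.support ∪ b.support).erase g :=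
        union_subset hcs1 hcs2
      obtain ⟨h, h1, h2, h3, h4⟩ := ih _
        (hn ▸ (card_le_card hsub2).trans_lt (card_erase_lt_of_mem (mem_union_left _ hga)))
        hc hc' hec hfc hyc' hyc rfl
      exact ⟨h, h1, (h2.trans hsub2).trans (erase_subset _ _), h3, h4⟩

/-- `L` cannot be split into two nonempty parts such that no circuit meets both. -/
def ConnIn (R : Submodule F (ι →₀ F)) (L : Finset ι) : Prop :=
  ∀ A ⊆ L, A.Nonempty → (L \ A).Nonempty →
    ∃ c, CircIn R c ∧ c.support ⊆ L ∧ (∃ x ∈ c.support, x ∈ A) ∧ ∃ y ∈ c.support, y ∉ A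

lemma conn_circ {R : Submodule F (ι →₀ F)} {L : Finset ι} (hL : ConnIn R L) {e f : ι}
    (he : e ∈ L) (hf : f ∈ L) (hef : e ≠ f) :
    ∃ c, CircIn R c ∧ c.support ⊆ L ∧ e ∈ c.support ∧ f ∈ c.support := by
  classical
  by_contra hno
  let A := L.filter (fun x => x = e ∨ ∃ c, CircIn R c ∧ c.support ⊆ L ∧ e ∈ c.support ∧ x ∈ c.support)
  have heA : e ∈ A := by simp [A, he]
  have hfA : f ∉ A := by
    intro h
    rcases (mem_filter.1 h).2 with h | h
    · exact hef h.symm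
    · exact hno h
  obtain ⟨c, hc, hcL, ⟨x, hx, hxA⟩, y, hy, hyA⟩ := hL A (filter_subset _ _) ⟨e, heA⟩
    ⟨f, mem_sdiff.2 ⟨hf, hfA⟩⟩
  apply hyA
  refine mem_filter.2 ⟨hcL hy, Or.inr ?_⟩
  rcases (mem_filter.1 hxA).2 with rfl | ⟨b, hb, hbL, heb, hxb⟩
  · exact ⟨c, hc, hcL, hx, hy⟩
  · obtain ⟨h, h1, h2, h3, h4⟩ := circ_trans hb hc heb hy hxb hx
    exact ⟨h, h1, h2.trans (union_subset hbL hcL), h3, h4⟩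

/-- A vector on a circuit has a representative with large proper support. -/
lemma exists_half {R : Submodule F (ι →₀ F)} {z x : ι →₀ F} (hz : CircIn R z)
    (hx : x.support ⊆ z.support) (hxR : x ∉ R) :
    ∃ x', x - x' ∈ R ∧ x'.support ⊆ z.support ∧ (∃ g ∈ z.support, g ∉ x'.support) ∧
      z.support.card ≤ 2 * x'.support.card := by
  have key : ∀ y : ι →₀ F, y.support ⊆ z.support → x - y ∈ R → ∀ g ∈ z.support,
      x - killAt y z g ∈ R ∧ (killAt y z g).support ⊆ z.support ∧ g ∉ (killAt y z g).support := by
    intro y hy hxy g hg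
    have hk := killAt_support y z g (Finsupp.mem_support_iff.1 hg)
    rw [union_eq_right.2 hy] at hk
    refine ⟨?_, hk.trans (erase_subset _ _), fun h => by simpa using hk h⟩
    have : x - killAt y z g = (x - y) + (y g / z g) • z := by simp [killAt]; abel
    rw [this]
    exact R.add_mem hxy (R.smul_mem _ hz.1)
  obtain ⟨g, hg⟩ := Finsupp.support_nonempty_iff.2 hz.2.1
  obtain ⟨h1, h2, h3⟩ := key x hx (by simp) g hg
  set x1 := killAt x z g with hx1
  have hx10 : x1 ≠ 0 := by intro h; rw [h] at h1; simp at h1; exact hxR h1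
  obtain ⟨g2, hg2⟩ := Finsupp.support_nonempty_iff.2 hx10
  obtain ⟨h4, h5, h6⟩ := key x1 h2 h1 g2 (h2 hg2)
  set x2 := killAt x1 z g2 with hx2
  have hcov : z.support ⊆ x1.support ∪ x2.support := by
    intro c hc
    by_contra hcn
    simp only [mem_union, not_or, Finsupp.mem_support_iff, not_not] at hcn
    obtain ⟨hcn1, hcn2⟩ := hcn
    rw [hx2, killAt_apply, hcn1, zero_sub, neg_eq_zero] at hcn2
    exact mul_ne_zero (div_ne_zero (Finsupp.mem_support_iff.1 hg2)
      (Finsupp.mem_support_iff.1 (h2 hg2))) (Finsupp.mem_support_iff.1 hc) hcn2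
  have hcard := (card_le_card hcov).trans (card_union_le _ _)
  by_cases hle : x1.support.card ≤ x2.support.card
  · exact ⟨x2, h4, h5, ⟨g2, h2 hg2, h6⟩, by omega⟩
  · exact ⟨x1, h1, h2, ⟨g, hg, h3⟩, by omega⟩

/-- The vectors supported on a finite set. -/
abbrev supOn (F : Type) [Field F] {ι : Type} (C : Finset ι) : Submodule F (ι →₀ F) :=
  Finsupp.supported F F (C : Set ι)

lemma mem_supOn {C : Finset ι} {a : ι →₀ F} : a ∈ supOn F C ↔ a.support ⊆ C := by
  rw [Finsupp.mem_supported]; exact Finset.coe_subset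

/-- Restriction of a vector to a finite set. -/
noncomputable def resTo (C : Finset ι) (a : ι →₀ F) : ι →₀ F := a.filter (fun i => i ∈ C)

lemma resTo_apply (C : Finset ι) (a : ι →₀ F) (i : ι) :
    resTo C a i = if i ∈ C then a i else 0 := by
  classical
  simp [resTo, Finsupp.filter_apply]

lemma mem_resTo_support {C : Finset ι} {a : ι →₀ F} {i : ι} :
    i ∈ (resTo C a).support ↔ i ∈ C ∧ i ∈ a.support := by
  rw [Finsupp.mem_support_iff, resTo_apply, Finsupp.mem_support_iff]
  split_ifs <;> simp [*]

lemma circ_single {R : Submodule F (ι →₀ F)} {a : ι →₀ F} (ha : CircIn R a) {C : Finset ι}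
    (hC : supOn F C ≤ R) {i : ι} (hi : i ∈ a.support) (hiC : i ∈ C) : a.support = {i} := by
  have h1 : Finsupp.single i (1 : F) ∈ R := by
    apply hC; rw [mem_supOn]
    exact Finsupp.support_single_subset.trans (by simpa using hiC)
  have h2 : (Finsupp.single i (1 : F)).support = {i} := by
    exact Finsupp.support_single i one_ne_zero
  apply subset_antisymm
  · rw [← h2]
    exact ha.2.2 _ h1 (by simp) (by rw [h2]; simpa using hi)
  · simpa using hi

/-- The skew case: two skew circuits on a common circuit give a longer circuit. -/
lemma skew_case {R : Submodule F (ι →₀ F)} {L : Finset ι} {z z' q : ι →₀ F}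
    (hz : CircIn R z) (hz' : CircIn R z') (hzL : z.support ⊆ L) (hzL' : z'.support ⊆ L)
    (hdisj : Disjoint z.support z'.support)
    (hskew : ∀ x y : ι →₀ F, x.support ⊆ z.support → y.support ⊆ z'.support → x + y ∈ R →
      x ∈ R ∧ y ∈ R)
    (hq : CircIn R q) (hqL : q.support ⊆ L) {e f : ι} (he : e ∈ z.support) (hf : f ∈ z'.support)
    (heq : e ∈ q.support) (hfq : f ∈ q.support) (hcard : z.support.card ≤ z'.support.card) :
    ∃ h, CircIn R h ∧ h.support ⊆ L ∧ z.support.card < h.support.card := by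
  classical
  set C := z.support with hC
  set C' := z'.support with hC'
  set U := R ⊔ supOn F C with hU
  set U' := R ⊔ supOn F C' with hU'
  have hdisj' : ∀ i, i ∈ C → i ∈ C' → False := fun i h1 h2 => (Finset.disjoint_left.1 hdisj) h1 h2
  let Spl : (ι →₀ F) → Prop := fun a => ∃ b1 ∈ U, ∃ b2 ∈ U', a = b1 + b2 ∧
    b1.support ⊆ a.support ∧ b2.support ⊆ a.support
  -- existence of a nonsplit vector
  have hex : ∃ a, a ∈ U ⊔ U' ∧ a.support ⊆ L ∧ ¬ Spl a := by
    set x := resTo C q with hx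
    set y := resTo C' q with hy
    have hxs : x.support ⊆ C := fun i hi => (mem_resTo_support.1 hi).1
    have hys : y.support ⊆ C' := fun i hi => (mem_resTo_support.1 hi).1
    refine ⟨q - x - y, ?_, ?_, ?_⟩
    · have h1 : q ∈ U := le_sup_left (a := R) hq.1
      have h2 : x ∈ U := le_sup_right (a := R) (mem_supOn.2 hxs)
      have h3 : y ∈ U' := le_sup_right (a := R) (mem_supOn.2 hys)
      exact sub_mem (le_sup_left (a := U) (U.sub_mem h1 h2)) (le_sup_right (a := U) h3)
    · intro i hi
      apply hqL
      rw [Finsupp.mem_support_iff] at hi ⊢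
      intro h0
      apply hi
      simp [hx, hy, resTo_apply, h0]
    · rintro ⟨b1, hb1, b2, hb2, hab, hs1, hs2⟩
      obtain ⟨r1, hr1, x1, hx1, rfl⟩ := Submodule.mem_sup.1 hb1
      obtain ⟨r2, hr2, y2, hy2, rfl⟩ := Submodule.mem_sup.1 hb2
      have hsum : (x1 + x) + (y2 + y) ∈ R := by
        have : (x1 + x) + (y2 + y) = q - r1 - r2 := by
          have : q = r1 + x1 + (r2 + y2) + x + y := by rw [← hab]; abel
          rw [this]; abel
        rw [this]
        exact R.sub_mem (R.sub_mem hq.1 hr1) hr2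
      have h1 := (hskew (x1 + x) (y2 + y) (Finsupp.support_add.trans (union_subset (mem_supOn.1 hx1) hxs))
        (Finsupp.support_add.trans (union_subset (mem_supOn.1 hy2) hys)) hsum).1
      have hoff : ∀ i, i ∈ C ∨ i ∈ C' → (q - x - y) i = 0 := by
        rintro i (hi | hi)
        · have : i ∉ C' := fun h => hdisj' i hi h
          simp [hx, hy, resTo_apply, hi, this]
        · have : i ∉ C := fun h => hdisj' i h hi
          simp [hx, hy, resTo_apply, hi, this]
      have hoff1 : ∀ i, i ∈ C ∨ i ∈ C' → (r1 + x1) i = 0 := by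
        intro i hi
        by_contra h
        exact Finsupp.mem_support_iff.1 (hs1 (Finsupp.mem_support_iff.2 h)) (hoff i hi)
      have h2 : (r1 + x1) + x ∈ R := by
        have : (r1 + x1) + x = r1 + (x1 + x) := by abel
        rw [this]; exact R.add_mem hr1 h1
      have h3 : ((r1 + x1) + x).support ⊆ q.support := by
        refine Finsupp.support_add.trans (union_subset ?_ (fun i hi => (mem_resTo_support.1 hi).2))
        intro i hi
        have hi2 := hs1 hi
        rw [Finsupp.mem_support_iff] at hi2 ⊢
        intro h0
        apply hi2
        simp [hx, hy, resTo_apply, h0]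
      have h4 : f ∉ ((r1 + x1) + x).support := by
        rw [Finsupp.notMem_support_iff, Finsupp.add_apply, hoff1 f (Or.inr hf), hx, resTo_apply]
        rw [if_neg (fun h => hdisj' f h hf), add_zero]
      have h5 := circ_of_subset_ssubset hq h2 h3 hfq h4
      have h6 := DFunLike.congr_fun h5 e
      rw [Finsupp.add_apply, hoff1 e (Or.inl he), hx, resTo_apply, if_pos he, zero_add] at h6
      exact Finsupp.mem_support_iff.1 heq h6
  -- a nonsplit vector of minimal support
  obtain ⟨a, ⟨haQ, haL, hans⟩, hamin⟩ := WellFounded.has_min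
    (InvImage.wf (fun a : ι →₀ F => a.support.card) Nat.lt_wfRel.wf)
    {a | a ∈ U ⊔ U' ∧ a.support ⊆ L ∧ ¬ Spl a} hex
  have hmin : ∀ b ∈ U ⊔ U', b.support ⊂ a.support → Spl b := by
    intro b hb hss
    by_contra hn
    exact hamin b ⟨hb, hss.1.trans haL, hn⟩ (card_lt_card hss)
  have ha0 : a ≠ 0 := by
    rintro rfl
    exact hans ⟨0, zero_mem _, 0, zero_mem _, by simp, by simp, by simp⟩
  have hacirc : CircIn (U ⊔ U') a := by
    refine ⟨haQ, ha0, ?_⟩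
    intro b hb hb0 hbs
    by_contra hns
    obtain ⟨b1, hb1, b2, hb2, hbb, hs1, hs2⟩ := hmin b hb ⟨hbs, hns⟩
    obtain ⟨g, hg⟩ := Finsupp.support_nonempty_iff.2 hb0
    have hk := killAt_support a b g (Finsupp.mem_support_iff.1 hg)
    rw [union_eq_left.2 hbs] at hk
    obtain ⟨d1, hd1, d2, hd2, hdd, ht1, ht2⟩ := hmin (killAt a b g) (killAt_mem haQ hb g)
      (hk.trans_ssubset (erase_ssubset (hbs hg)))
    have hk' := hk.trans (erase_subset _ _)
    apply hans
    refine ⟨d1 + (a g / b g) • b1, U.add_mem hd1 (U.smul_mem _ hb1),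
      d2 + (a g / b g) • b2, U'.add_mem hd2 (U'.smul_mem _ hb2), ?_, ?_, ?_⟩
    · have : a = killAt a b g + (a g / b g) • b := by simp [killAt]
      calc a = killAt a b g + (a g / b g) • b := this
        _ = (d1 + d2) + (a g / b g) • (b1 + b2) := by rw [← hdd, ← hbb]
        _ = _ := by rw [smul_add]; abel
    · exact Finsupp.support_add.trans (union_subset (ht1.trans hk')
        (Finsupp.support_smul.trans (hs1.trans hbs)))
    · exact Finsupp.support_add.trans (union_subset (ht2.trans hk')
        (Finsupp.support_smul.trans (hs2.trans hbs)))
  have hanU : a ∉ U := fun h => hans ⟨a, h, 0, zero_mem _, by simp, subset_rfl, by simp⟩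
  have hanU' : a ∉ U' := fun h => hans ⟨0, zero_mem _, a, h, by simp, by simp, subset_rfl⟩
  have haC : ∀ i ∈ a.support, i ∉ C := by
    intro i hi hiC
    have := circ_single hacirc (C := C) (le_sup_right.trans le_sup_left) hi hiC
    exact hanU (le_sup_right (a := R) (mem_supOn.2 (by rw [this]; simpa using hiC)))
  have haC' : ∀ i ∈ a.support, i ∉ C' := by
    intro i hi hiC
    have := circ_single hacirc (C := C') (le_sup_right.trans le_sup_right) hi hiC
    exact hanU' (le_sup_right (a := R) (mem_supOn.2 (by rw [this]; simpa using hiC)))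
  obtain ⟨u, hu, u', hu', hauu⟩ := Submodule.mem_sup.1 haQ
  obtain ⟨r1, hr1, x, hx, rfl⟩ := Submodule.mem_sup.1 hu
  obtain ⟨r2, hr2, y, hy, rfl⟩ := Submodule.mem_sup.1 hu'
  have hxR : x ∉ R := by
    intro h
    apply hanU'
    rw [← hauu]
    exact U'.add_mem (le_sup_left (a := R) (R.add_mem hr1 h)) hu'
  have hyR : y ∉ R := by
    intro h
    apply hanU
    rw [← hauu]
    exact U.add_mem hu (le_sup_left (a := R) (R.add_mem hr2 h))
  obtain ⟨x', hxx', hx's, ⟨g1, hg1, hg1'⟩, hxc⟩ := exists_half hz (mem_supOn.1 hx) hxR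
  obtain ⟨y', hyy', hy's, ⟨g2, hg2, hg2'⟩, hyc⟩ := exists_half hz' (mem_supOn.1 hy) hyR
  have hhR : a - x' - y' ∈ R := by
    have : a - x' - y' = r1 + r2 + (x - x') + (y - y') := by rw [← hauu]; abel
    rw [this]
    exact R.add_mem (R.add_mem (R.add_mem hr1 hr2) hxx') hyy'
  have hval : ∀ i, (a - x' - y') i = a i - x' i - y' i := fun i => by simp
  have hx'0 : ∀ i, i ∉ C → x' i = 0 := fun i hi => Finsupp.notMem_support_iff.1 fun h => hi (hx's h)
  have hy'0 : ∀ i, i ∉ C' → y' i = 0 := fun i hi => Finsupp.notMem_support_iff.1 fun h => hi (hy's h)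
  have ha0' : ∀ i, i ∈ C ∨ i ∈ C' → a i = 0 := fun i hi => Finsupp.notMem_support_iff.1 fun h =>
    hi.elim (haC i h) (haC' i h)
  have hsupp : (a - x' - y').support = a.support ∪ (x'.support ∪ y'.support) := by
    ext i
    simp only [mem_union, Finsupp.mem_support_iff, hval]
    by_cases h1 : i ∈ C
    · have h2 : i ∉ C' := fun h => hdisj' i h1 h
      simp [ha0' i (Or.inl h1), hy'0 i h2]
    · by_cases h2 : i ∈ C'
      · simp [ha0' i (Or.inr h2), hx'0 i h1]
      · simp [hx'0 i h1, hy'0 i h2]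
  obtain ⟨p, hp⟩ := Finsupp.support_nonempty_iff.2 ha0
  obtain ⟨h', hh', hh's, hph'⟩ := exists_circ hhR (e := p) (by rw [hsupp]; exact mem_union_left _ hp)
  rw [hsupp] at hh's
  set xx := resTo C h' with hxxd
  set yy := resTo C' h' with hyyd
  have hxxs : xx.support ⊆ C := fun i hi => (mem_resTo_support.1 hi).1
  have hyys : yy.support ⊆ C' := fun i hi => (mem_resTo_support.1 hi).1
  have hxxs' : xx.support ⊆ x'.support := by
    intro i hi
    have hi' := mem_resTo_support.1 hi
    have := hh's hi'.2
    simp only [mem_union] at this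
    rcases this with h | h | h
    · exact absurd hi'.1 (haC i h)
    · exact h
    · exact (hdisj' i hi'.1 (hy's h)).elim
  have hyys' : yy.support ⊆ y'.support := by
    intro i hi
    have hi' := mem_resTo_support.1 hi
    have := hh's hi'.2
    simp only [mem_union] at this
    rcases this with h | h | h
    · exact absurd hi'.1 (haC' i h)
    · exact (hdisj' i (hx's h) hi'.1).elim
    · exact h
  have haas : (h' - xx - yy).support ⊆ a.support := by
    intro i hi
    have hne := Finsupp.mem_support_iff.1 hi
    have hiC : i ∉ C := by
      intro h
      have : i ∉ C' := fun h2 => hdisj' i h h2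
      apply hne; simp [hxxd, hyyd, resTo_apply, h, this]
    have hiC' : i ∉ C' := by
      intro h
      apply hne; simp [hxxd, hyyd, resTo_apply, h, hiC]
    have h3 : i ∈ h'.support := by
      rw [Finsupp.mem_support_iff]
      intro h0
      apply hne; simp [hxxd, hyyd, resTo_apply, h0]
    have := hh's h3
    simp only [mem_union] at this
    rcases this with h | h | h
    · exact h
    · exact (hiC (hx's h)).elim
    · exact (hiC' (hy's h)).elim
  have haaQ : h' - xx - yy ∈ U ⊔ U' := by
    have h1 : h' ∈ U := le_sup_left (a := R) hh'.1
    have h2 : xx ∈ U := le_sup_right (a := R) (mem_supOn.2 hxxs)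
    have h3 : yy ∈ U' := le_sup_right (a := R) (mem_supOn.2 hyys)
    exact sub_mem (le_sup_left (a := U) (U.sub_mem h1 h2)) (le_sup_right (a := U) h3)
  obtain ⟨t, ht⟩ := circ_unique hacirc haaQ haas
  have hpa : (h' - xx - yy) p ≠ 0 := by
    have h1 := haC p hp
    have h2 := haC' p hp
    have : (h' - xx - yy) p = h' p := by simp [hxxd, hyyd, resTo_apply, h1, h2]
    rw [this]; exact Finsupp.mem_support_iff.1 hph'
  have ht0 : t ≠ 0 := by
    rintro rfl
    rw [ht] at hpa; simp at hpa
  have hdiff : (xx + t • x') + (yy + t • y') ∈ R := by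
    have : (xx + t • x') + (yy + t • y') = h' - t • (a - x' - y') := by
      have h1 : h' = t • a + xx + yy := by rw [← ht]; abel
      rw [smul_sub, smul_sub]
      nth_rewrite 1 [h1]
      abel
    rw [this]
    exact R.sub_mem hh'.1 (R.smul_mem _ hhR)
  have hsx : (xx + t • x').support ⊆ x'.support :=
    Finsupp.support_add.trans (union_subset hxxs' Finsupp.support_smul)
  have hsy : (yy + t • y').support ⊆ y'.support :=
    Finsupp.support_add.trans (union_subset hyys' Finsupp.support_smul)
  obtain ⟨hdx, hdy⟩ := hskew _ _ (hsx.trans hx's) (hsy.trans hy's) hdiff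
  have hx0 := circ_of_subset_ssubset hz hdx (hsx.trans hx's) hg1 (fun h => hg1' (hsx h))
  have hy0 := circ_of_subset_ssubset hz' hdy (hsy.trans hy's) hg2 (fun h => hg2' (hsy h))
  have hfin : h' = t • (a - x' - y') := by
    have h1 : h' = t • a + xx + yy := by rw [← ht]; abel
    have h2 : xx = - (t • x') := eq_neg_of_add_eq_zero_left hx0
    have h3 : yy = - (t • y') := eq_neg_of_add_eq_zero_left hy0
    rw [h1, h2, h3, smul_sub, smul_sub]; abel
  have hsuppeq : h'.support = a.support ∪ (x'.support ∪ y'.support) := by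
    rw [hfin, Finsupp.support_smul_eq ht0, hsupp]
  refine ⟨h', hh', ?_, ?_⟩
  · rw [hsuppeq]
    exact union_subset haL (union_subset (hx's.trans hzL) (hy's.trans hzL'))
  · have d2 : Disjoint x'.support y'.support :=
      Finset.disjoint_left.2 fun i h1 h2 => hdisj' i (hx's h1) (hy's h2)
    have d1 : Disjoint a.support (x'.support ∪ y'.support) := by
      refine Finset.disjoint_left.2 fun i h1 h2 => ?_
      rcases mem_union.1 h2 with h | h
      · exact haC i h1 (hx's h)
      · exact haC' i h1 (hy's h)
    rw [hsuppeq, card_union_of_disjoint d1, card_union_of_disjoint d2]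
    have : 0 < a.support.card := card_pos.2 ⟨p, hp⟩
    rw [← hC] at hxc
    rw [← hC'] at hyc
    omega

/-- Contracting a largest circuit of a connected set decreases the circumference. -/
lemma contract_circ {R : Submodule F (ι →₀ F)} {L : Finset ι} (hL : ConnIn R L) {z : ι →₀ F}
    (hz : CircIn R z) (hzL : z.support ⊆ L) (h2 : 2 ≤ z.support.card)
    (hmax : ∀ c, CircIn R c → c.support ⊆ L → c.support.card ≤ z.support.card)
    {c : ι →₀ F} (hc : CircIn (R ⊔ supOn F z.support) c) (hcL : c.support ⊆ L) :
    c.support.card < z.support.card := by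
  classical
  by_contra! hge
  have hdis : ∀ i ∈ c.support, i ∉ z.support := by
    intro i hi hiz
    have := circ_single hc le_sup_right hi hiz
    rw [this, card_singleton] at hge
    omega
  have hc0 := hc.2.1
  obtain ⟨e, he⟩ := Finsupp.support_nonempty_iff.2 hc0
  by_cases hcR : c ∈ R
  · have hcc : CircIn R c := ⟨hcR, hc0, fun b hb => hc.2.2 b (le_sup_left (a := R) hb)⟩
    obtain ⟨g, hg⟩ := Finsupp.support_nonempty_iff.2 hz.2.1
    obtain ⟨q, hq, hqL, hgq, heq⟩ := conn_circ hL (hzL hg) (hcL he)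
      (fun h => hdis e he (h ▸ hg))
    obtain ⟨h, hh, hhL, hlt⟩ := skew_case hz hcc hzL hcL
      (Finset.disjoint_left.2 fun i h1 h2 => hdis i h2 h1) (by
        intro x y hx hy hxy
        have hyU : y ∈ R ⊔ supOn F z.support := by
          have : y = (x + y) - x := by abel
          rw [this]
          exact sub_mem (le_sup_left (a := R) hxy) (le_sup_right (a := R) (mem_supOn.2 hx))
        obtain ⟨t, rfl⟩ := circ_unique hc hyU hy
        have hyR : t • c ∈ R := R.smul_mem _ hcR
        refine ⟨?_, hyR⟩
        have : x = (x + t • c) - t • c := by abel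
        rw [this]
        exact R.sub_mem hxy hyR) hq hqL hg he hgq heq hge
    exact absurd (hmax h hh hhL) (by omega)
  · obtain ⟨r, hr, x, hx, hrx⟩ := Submodule.mem_sup.1 hc.1
    have hxs := mem_supOn.1 hx
    have hrv : ∀ i, i ∉ z.support → r i = c i := by
      intro i hi
      rw [← hrx, Finsupp.add_apply, Finsupp.notMem_support_iff.1 (fun h => hi (hxs h)), add_zero]
    have her : e ∈ r.support := by
      rw [Finsupp.mem_support_iff, hrv e (hdis e he)]; exact Finsupp.mem_support_iff.1 he
    have hrs : ∀ i ∈ r.support, i ∈ c.support ∨ i ∈ z.support := by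
      intro i hi
      by_cases h : i ∈ z.support
      · exact Or.inr h
      · left
        rw [Finsupp.mem_support_iff, ← hrv i h]; exact Finsupp.mem_support_iff.1 hi
    obtain ⟨h, hh, hhs, heh⟩ := exists_circ hr her
    set xx := resTo z.support h with hxx
    have hb : h - xx ∈ R ⊔ supOn F z.support :=
      sub_mem (le_sup_left (a := R) hh.1)
        (le_sup_right (a := R) (mem_supOn.2 fun i hi => (mem_resTo_support.1 hi).1))
    have hbv : ∀ i, (h - xx) i = if i ∈ z.support then 0 else h i := by
      intro i
      rw [Finsupp.sub_apply, hxx, resTo_apply]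
      split_ifs <;> simp
    have hbs : (h - xx).support ⊆ c.support := by
      intro i hi
      have hi' := Finsupp.mem_support_iff.1 hi
      rw [hbv] at hi'
      split_ifs at hi' with h1
      · exact absurd rfl hi'
      · exact (hrs i (hhs (Finsupp.mem_support_iff.2 hi'))).resolve_right h1
    have hb0 : h - xx ≠ 0 := by
      intro h0
      have := DFunLike.congr_fun h0 e
      rw [hbv, if_neg (hdis e he)] at this
      exact Finsupp.mem_support_iff.1 heh this
    have hcs := hc.2.2 _ hb hb0 hbs
    have hch : c.support ⊆ h.support := by
      intro i hi
      have hi' := Finsupp.mem_support_iff.1 (hcs hi)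
      rw [hbv, if_neg (hdis i hi)] at hi'
      exact Finsupp.mem_support_iff.2 hi'
    have hhL : h.support ⊆ L := fun i hi => (hrs i (hhs hi)).elim (fun h => hcL h) (fun h => hzL h)
    have hle := hmax h hh hhL
    have heqs : c.support = h.support := eq_of_subset_of_card_le hch (by omega)
    obtain ⟨t, ht⟩ := circ_unique hc (le_sup_left (a := R) hh.1) heqs.ge
    have ht0 : t ≠ 0 := by
      rintro rfl
      exact hh.2.1 (by simpa using ht)
    apply hcR
    have : c = t⁻¹ • h := by rw [ht, smul_smul, inv_mul_cancel₀ ht0, one_smul]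
    rw [this]
    exact R.smul_mem _ hh.1


/-- No nonzero vector of `R` is supported on `I`. -/
def IndepIn (R : Submodule F (ι →₀ F)) (I : Finset ι) : Prop :=
  ∀ a ∈ R, a.support ⊆ I → a = 0

lemma indep_union {R : Submodule F (ι →₀ F)} {L A I J : Finset ι}
    (hno : ∀ c, CircIn R c → c.support ⊆ L → (∃ x ∈ c.support, x ∈ A) → ∀ y ∈ c.support, y ∈ A)
    (hAL : A ⊆ L) (hI : I ⊆ A) (hJ : J ⊆ L \ A) (hIi : IndepIn R I) (hJi : IndepIn R J) :
    IndepIn R (I ∪ J) := by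
  intro a ha has
  by_contra h0
  obtain ⟨e, he⟩ := Finsupp.support_nonempty_iff.2 h0
  obtain ⟨c, hc, hcs, -⟩ := exists_circ ha he
  have hcIJ := hcs.trans has
  have hIL : I ∪ J ⊆ L := union_subset (hI.trans hAL) (hJ.trans sdiff_subset)
  by_cases hx : ∃ x ∈ c.support, x ∈ A
  · have h1 := hno c hc (hcIJ.trans hIL) hx
    refine hc.2.1 (hIi c hc.1 fun i hi => ?_)
    rcases mem_union.1 (hcIJ hi) with h | h
    · exact h
    · exact absurd (h1 i hi) (mem_sdiff.1 (hJ h)).2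
  · push Not at hx
    refine hc.2.1 (hJi c hc.1 fun i hi => ?_)
    rcases mem_union.1 (hcIJ hi) with h | h
    · exact absurd (hI h) (hx i hi)
    · exact h

lemma indep_contract {R : Submodule F (ι →₀ F)} {I : Finset ι} {z : ι →₀ F} (hz : CircIn R z)
    (hdis : Disjoint I z.support) (hI : IndepIn (R ⊔ supOn F z.support) I) {g : ι}
    (hg : g ∈ z.support) : IndepIn R (I ∪ z.support.erase g) := by
  intro a ha has
  have h1 : a - resTo z.support a ∈ R ⊔ supOn F z.support :=
    sub_mem (le_sup_left (a := R) ha)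
      (le_sup_right (a := R) (mem_supOn.2 fun i hi => (mem_resTo_support.1 hi).1))
  have h2 : a - resTo z.support a = 0 := by
    apply hI _ h1
    intro i hi
    rw [Finsupp.mem_support_iff, Finsupp.sub_apply, resTo_apply] at hi
    split_ifs at hi with h
    · simp at hi
    · rw [sub_zero] at hi
      rcases mem_union.1 (has (Finsupp.mem_support_iff.2 hi)) with h' | h'
      · exact h'
      · exact absurd (mem_of_mem_erase h') h
  have h3 : a.support ⊆ z.support := by
    intro i hi
    rw [sub_eq_zero] at h2
    rw [h2] at hi
    exact (mem_resTo_support.1 hi).1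
  refine circ_of_subset_ssubset hz ha h3 hg fun h => ?_
  rcases mem_union.1 (has h) with h' | h'
  · exact Finset.disjoint_left.1 hdis h' hg
  · simp at h'

end Circ

section Faces
variable {F : Type} [Field F] {V : Type} [LinearOrder V]

/-- The codimension-one faces of a simplex. -/
def facesOf (σ : Finset V) : Finset (Finset V) := σ.image (fun v => σ.erase v)

lemma card_facesOf (σ : Finset V) : (facesOf σ).card = σ.card :=
  card_image_of_injOn (erase_injOn σ)

lemma sbdry_ne_iff (σ τ : Finset V) : sbdry F σ τ ≠ 0 ↔ τ ∈ facesOf σ := by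
  classical
  have hval : sbdry F σ τ = ∑ v ∈ σ, ((-1 : F) ^ ((σ.filter (fun w => w < v)).card)) *
      (if σ.erase v = τ then 1 else 0) := by
    simp [sbdry, Finsupp.finset_sum_apply, Finsupp.single_apply]
  constructor
  · intro h
    by_contra hn
    apply h
    rw [hval]
    refine sum_eq_zero fun v hv => ?_
    rw [if_neg, mul_zero]
    rintro rfl
    exact hn (mem_image_of_mem _ hv)
  · intro h
    obtain ⟨v, hv, rfl⟩ := mem_image.1 h
    rw [hval, sum_eq_single_of_mem v hv]
    · simp
    · intro w hw hwv
      rw [if_neg, mul_zero]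
      intro h
      exact hwv (erase_injOn σ hw hv h)

/-- Two distinct simplices of the same size have at most one common face. -/
lemma common_face {σ σ' τ ρ : Finset V}
    (h1 : τ ∈ facesOf σ) (h2 : τ ∈ facesOf σ') (h3 : ρ ∈ facesOf σ) (h4 : ρ ∈ facesOf σ')
    (hne : τ ≠ ρ) : σ = σ' := by
  have key : ∀ s : Finset V, τ ∈ facesOf s → ρ ∈ facesOf s → s = τ ∪ ρ := by
    intro s hs1 hs2
    obtain ⟨v, hv, rfl⟩ := mem_image.1 hs1
    obtain ⟨w, hw, rfl⟩ := mem_image.1 hs2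
    have hvw : v ≠ w := fun h => hne (by rw [h])
    ext x
    simp only [mem_union, mem_erase]
    by_cases hx : x = v
    · subst hx; tauto
    · tauto
  rw [key σ h1 h3, key σ' h2 h4]

/-- Number of simplices with all faces in `S` through a given face. -/
lemma star_bound (d : ℕ) (L S : Finset (Finset V)) (hL : ∀ σ ∈ L, σ.card = d + 1)
    (τ : Finset V) :
    d * (L.filter (fun σ => τ ∈ facesOf σ ∧ facesOf σ ⊆ S)).card ≤ S.card := by
  classical
  set Q := L.filter (fun σ => τ ∈ facesOf σ ∧ facesOf σ ⊆ S) with hQ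
  have hdisj : (Q : Set (Finset V)).PairwiseDisjoint (fun σ => (facesOf σ).erase τ) := by
    intro σ hσ σ' hσ' hne
    refine Finset.disjoint_left.2 fun ρ h1 h2 => hne ?_
    have hs := (mem_filter.1 (mem_coe.1 hσ)).2
    have hs' := (mem_filter.1 (mem_coe.1 hσ')).2
    exact common_face hs.1 hs'.1 (mem_of_mem_erase h1) (mem_of_mem_erase h2) (ne_of_mem_erase h1).symm
  have hcard : (Q.biUnion (fun σ => (facesOf σ).erase τ)).card = Q.card * d := by
    rw [card_biUnion hdisj, sum_const_nat]
    intro σ hσ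
    have hs := mem_filter.1 hσ
    rw [card_erase_of_mem hs.2.1, card_facesOf, hL σ hs.1]; rfl
  rw [mul_comm, ← hcard]
  apply card_le_card
  intro ρ hρ
  obtain ⟨σ, hσ, h⟩ := mem_biUnion.1 hρ
  exact (mem_filter.1 hσ).2.2 (mem_of_mem_erase h)

/-- New faces of a circuit lie in at least two of its simplices. -/
lemma new_faces_bound (d : ℕ) (S : Finset (Finset V)) (z : Finset V →₀ F)
    (hz : ∀ σ ∈ z.support, σ.card = d + 1)
    (hS : (Finsupp.linearCombination F (sbdry F) z).support ⊆ S) :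
    2 * ((z.support.biUnion facesOf) \ S).card ≤ (d + 1) * z.support.card := by
  classical
  set N := (z.support.biUnion facesOf) \ S with hN
  have h1 : ∀ τ ∈ N, 2 ≤ (bipartiteBelow (fun σ τ => τ ∈ facesOf σ) z.support τ).card := by
    intro τ hτ
    obtain ⟨hτ1, hτ2⟩ := mem_sdiff.1 hτ
    obtain ⟨σ, hσ, hτσ⟩ := mem_biUnion.1 hτ1
    by_contra! hlt
    have hall : ∀ σ' ∈ z.support, σ' ≠ σ → τ ∉ facesOf σ' := by
      intro σ' hσ' hne hτ'
      have : 1 < (bipartiteBelow (fun σ τ => τ ∈ facesOf σ) z.support τ).card :=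
        one_lt_card.2 ⟨σ', by simp only [mem_bipartiteBelow]; exact ⟨hσ', hτ'⟩, σ,
          by simp only [mem_bipartiteBelow]; exact ⟨hσ, hτσ⟩, hne⟩
      omega
    have h0 : (Finsupp.linearCombination F (sbdry F) z) τ = 0 :=
      Finsupp.notMem_support_iff.1 fun h => hτ2 (hS h)
    rw [Finsupp.linearCombination_apply, Finsupp.sum, Finsupp.finset_sum_apply,
      sum_eq_single_of_mem σ hσ] at h0
    · rw [Finsupp.smul_apply, smul_eq_mul] at h0
      exact mul_ne_zero (Finsupp.mem_support_iff.1 hσ) ((sbdry_ne_iff σ τ).2 hτσ) h0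
    · intro σ' hσ' hne
      have : sbdry F σ' τ = 0 := by
        by_contra h
        exact hall σ' hσ' hne ((sbdry_ne_iff σ' τ).1 h)
      rw [Finsupp.smul_apply, this, smul_zero]
  have h2 : ∀ σ ∈ z.support, (bipartiteAbove (fun σ τ => τ ∈ facesOf σ) N σ).card ≤ d + 1 := by
    intro σ hσ
    rw [← hz σ hσ, ← card_facesOf σ]
    apply card_le_card
    intro τ hτ
    exact ((mem_bipartiteAbove _).1 hτ).2
  have h3 := sum_card_bipartiteAbove_eq_sum_card_bipartiteBelow (s := z.support) (t := N)
    (fun σ τ => τ ∈ facesOf σ)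
  have h4 : N.card * 2 ≤ ∑ τ ∈ N, (bipartiteBelow (fun σ τ => τ ∈ facesOf σ) z.support τ).card := by
    rw [← smul_eq_mul]; exact card_nsmul_le_sum _ _ _ h1
  have h5 : ∑ σ ∈ z.support, (bipartiteAbove (fun σ τ => τ ∈ facesOf σ) N σ).card
      ≤ z.support.card * (d + 1) := by
    rw [← smul_eq_mul]; exact sum_le_card_nsmul _ _ _ h2
  rw [mul_comm, mul_comm (d + 1)]
  omega

/-- The main induction. -/
lemma main_induction (d k : ℕ) (hd : 1 ≤ d) (hk : 1 ≤ k) (n : ℕ) :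
    ∀ (L S : Finset (Finset V)) (R : Submodule F (Finset V →₀ F)) (j : ℕ), L.card = n →
      (∀ σ ∈ L, σ.card = d + 1) →
      (∀ a ∈ R, (Finsupp.linearCombination F (sbdry F) a).support ⊆ S) →
      (∀ c, CircIn R c → c.support ⊆ L → c.support.card ≤ j) →
      4 * S.card + (d + 1) * (j * (j + 1)) ≤ (d + 1) * (k * (k + 1)) →
      ∃ I ⊆ L, IndepIn R I ∧
        2 * (L.filter (fun σ => ¬ facesOf σ ⊆ S)).card ≤ (d + 1) * (k * (k + 1)) * I.card := by
  classical
  induction n using Nat.strong_induction_on with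
  | _ n ih =>
  intro L S R j hn hL hS hj hbd
  have hD : 2 ≤ (d + 1) * (k * (k + 1)) := by
    have h1 : 1 ≤ k * (k + 1) := Nat.mul_pos hk (Nat.succ_pos _)
    calc 2 = 2 * 1 := rfl
      _ ≤ _ := Nat.mul_le_mul (by omega) h1
  rcases Nat.lt_or_ge n 2 with hn2 | hn2
  · -- at most one simplex
    by_cases hE : ∀ σ ∈ L, facesOf σ ⊆ S
    · refine ⟨∅, empty_subset _, fun a _ has => by simpa using has, ?_⟩
      rw [filter_false_of_mem (fun σ hσ h => h (hE σ hσ))]; simp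
    · push Not at hE
      obtain ⟨σ, hσ, hσS⟩ := hE
      have hc1 : L.card = 1 := by
        have h0 : 0 < L.card := card_pos.2 ⟨σ, hσ⟩
        omega
      have hLs : L = {σ} := (card_eq_one.1 hc1).elim
        (fun x hx => by rw [hx] at hσ ⊢; rw [mem_singleton.1 hσ])
      refine ⟨L, subset_rfl, ?_, ?_⟩
      · intro a ha has
        by_contra h0
        apply hσS
        rw [hLs] at has
        obtain ⟨t, ht⟩ : ∃ t, a = Finsupp.single σ t := by
          refine ⟨a σ, ?_⟩
          exact Finsupp.eq_single_iff.2 ⟨has, rfl⟩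
        have ht0 : t ≠ 0 := by rintro rfl; simp at ht; exact h0 ht
        intro τ hτ
        apply hS a ha
        rw [ht, Finsupp.linearCombination_single, Finsupp.mem_support_iff, Finsupp.smul_apply,
          smul_eq_mul]
        exact mul_ne_zero ht0 ((sbdry_ne_iff σ τ).2 hτ)
      · have h1 : (L.filter (fun σ => ¬ facesOf σ ⊆ S)).card ≤ L.card := card_filter_le _ _
        have h2 : L.card = 1 := by rw [hLs]; simp
        rw [h2] at h1 ⊢
        omega
  by_cases hconn : ConnIn R L
  · -- connected case
    obtain ⟨e, he, f, hf, hef⟩ := one_lt_card.1 (show 1 < L.card by omega)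
    obtain ⟨q, hq, hqL, heq, hfq⟩ := conn_circ hconn he hf hef
    -- a circuit of maximal size
    have hexm : ∃ m, ∃ z, CircIn R z ∧ z.support ⊆ L ∧ z.support.card = m := ⟨_, q, hq, hqL, rfl⟩
    have hbdd : ∀ m, (∃ z, CircIn R z ∧ z.support ⊆ L ∧ z.support.card = m) → m ≤ j := by
      rintro m ⟨z, h1, h2, rfl⟩; exact hj z h1 h2
    obtain ⟨z, hz, hzL, hzm⟩ := Nat.findGreatest_spec
      (P := fun m => ∃ z, CircIn R z ∧ z.support ⊆ L ∧ z.support.card = m)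
      (hbdd _ ⟨q, hq, hqL, rfl⟩) ⟨q, hq, hqL, rfl⟩
    have hmax : ∀ c, CircIn R c → c.support ⊆ L → c.support.card ≤ z.support.card := by
      intro c hc hcL
      rw [hzm]
      exact Nat.le_findGreatest (hj c hc hcL) ⟨c, hc, hcL, rfl⟩
    have hq2 : 2 ≤ q.support.card := one_lt_card.2 ⟨e, heq, f, hfq, hef⟩
    have hz2 : 2 ≤ z.support.card := hq2.trans (hmax q hq hqL)
    have hzj : z.support.card ≤ j := hj z hz hzL
    clear hzm
    set m := z.support.card with hm
    set S' := S ∪ z.support.biUnion facesOf with hS'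
    set N := (z.support.biUnion facesOf) \ S with hN
    have hNb : 2 * N.card ≤ (d + 1) * m :=
      new_faces_bound d S z (fun σ hσ => hL σ (hzL hσ)) (hS z hz.1)
    have hS'c : S'.card ≤ S.card + N.card := by
      have : S' = S ∪ N := by rw [hS', hN, union_sdiff_self_eq_union]
      rw [this]; exact card_union_le _ _
    obtain ⟨g, hg⟩ := Finsupp.support_nonempty_iff.2 hz.2.1
    obtain ⟨p, hp⟩ : ∃ p, m = p + 1 := ⟨m - 1, by omega⟩
    have hbd' : 4 * S'.card + (d + 1) * (p * (p + 1)) ≤ (d + 1) * (k * (k + 1)) := by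
      have h1 : (d + 1) * (m * (m + 1)) ≤ (d + 1) * (j * (j + 1)) := by gcongr
      have h2 : (d + 1) * (m * (m + 1)) = (d + 1) * (p * (p + 1)) + 2 * ((d + 1) * m) := by
        rw [hp]; ring
      omega
    obtain ⟨I, hIL, hI, hIc⟩ := ih (L \ z.support).card
      (by rw [← hn]; exact card_lt_card ⟨sdiff_subset, fun h => (mem_sdiff.1 (h (hzL hg))).2 hg⟩)
      (L \ z.support) S' (R ⊔ supOn F z.support) p rfl
      (fun σ hσ => hL σ (mem_sdiff.1 hσ).1)
      (by
        intro a ha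
        obtain ⟨r, hr, x, hx, rfl⟩ := Submodule.mem_sup.1 ha
        rw [map_add]
        refine Finsupp.support_add.trans (union_subset ((hS r hr).trans subset_union_left) ?_)
        intro τ hτ
        apply mem_union_right
        rw [Finsupp.mem_support_iff, Finsupp.linearCombination_apply, Finsupp.sum,
          Finsupp.finset_sum_apply] at hτ
        obtain ⟨σ, hσ, hne⟩ := exists_ne_zero_of_sum_ne_zero hτ
        refine mem_biUnion.2 ⟨σ, mem_supOn.1 hx hσ, ?_⟩
        rw [← sbdry_ne_iff (F := F)]
        intro h0
        apply hne
        rw [Finsupp.smul_apply, h0, smul_zero])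
      (by
        intro c hc hcL
        have := contract_circ hconn hz hzL hz2 hmax hc (hcL.trans sdiff_subset)
        omega)
      hbd'
    have hdis : Disjoint I z.support :=
      Finset.disjoint_left.2 fun i h1 h2 => (mem_sdiff.1 (hIL h1)).2 h2
    refine ⟨I ∪ z.support.erase g, union_subset (hIL.trans sdiff_subset)
      ((erase_subset _ _).trans hzL), indep_contract hz hdis hI hg, ?_⟩
    have hIcard : (I ∪ z.support.erase g).card = I.card + p := by
      rw [card_union_of_disjoint (hdis.mono_right (erase_subset _ _)), card_erase_of_mem hg]
      omega
    -- the simplices newly covered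
    set Q := L.filter (fun σ => facesOf σ ⊆ S' ∧ ¬ facesOf σ ⊆ S) with hQ
    have hcover : L.filter (fun σ => ¬ facesOf σ ⊆ S) ⊆
        (L \ z.support).filter (fun σ => ¬ facesOf σ ⊆ S') ∪ Q := by
      intro σ hσ
      obtain ⟨h1, h2⟩ := mem_filter.1 hσ
      by_cases h3 : facesOf σ ⊆ S'
      · exact mem_union_right _ (mem_filter.2 ⟨h1, h3, h2⟩)
      · refine mem_union_left _ (mem_filter.2 ⟨mem_sdiff.2 ⟨h1, fun h => h3 ?_⟩, h3⟩)
        exact (subset_biUnion_of_mem facesOf h).trans subset_union_right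
    have hQb : d * Q.card ≤ N.card * S'.card := by
      have h1 : Q ⊆ N.biUnion (fun τ => L.filter (fun σ => τ ∈ facesOf σ ∧ facesOf σ ⊆ S')) := by
        intro σ hσ
        obtain ⟨h1, h2, h3⟩ := mem_filter.1 hσ
        obtain ⟨τ, hτ, hτS⟩ := not_subset.1 h3
        have hτN : τ ∈ N := mem_sdiff.2 ⟨(mem_union.1 (h2 hτ)).resolve_left hτS, hτS⟩
        exact mem_biUnion.2 ⟨τ, hτN, mem_filter.2 ⟨h1, hτ, h2⟩⟩
      calc d * Q.card ≤ d * ∑ τ ∈ N, (L.filter (fun σ => τ ∈ facesOf σ ∧ facesOf σ ⊆ S')).card :=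
            Nat.mul_le_mul_left _ ((card_le_card h1).trans card_biUnion_le)
        _ = ∑ τ ∈ N, d * (L.filter (fun σ => τ ∈ facesOf σ ∧ facesOf σ ⊆ S')).card := mul_sum _ _ _
        _ ≤ ∑ _τ ∈ N, S'.card := sum_le_sum fun τ _ => star_bound d L S' hL τ
        _ = N.card * S'.card := by simp
    have hc1 := (card_le_card hcover).trans (card_union_le _ _)
    have hfin : 2 * Q.card ≤ (d + 1) * (k * (k + 1)) * p := by
      set D := (d + 1) * (k * (k + 1)) with hDdef
      have hN' : N.card ≤ (d + 1) * p := by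
        have : (d + 1) * m ≤ 2 * ((d + 1) * p) := by
          have : m ≤ 2 * p := by omega
          calc (d + 1) * m ≤ (d + 1) * (2 * p) := by gcongr
            _ = _ := by ring
        omega
      have hS4 : 4 * S'.card ≤ D := by omega
      have h1 : 4 * (d * Q.card) ≤ (d + 1) * p * D := by
        calc 4 * (d * Q.card) ≤ 4 * (N.card * S'.card) := by gcongr
          _ = N.card * (4 * S'.card) := by ring
          _ ≤ (d + 1) * p * D := by gcongr
      have h2 : (d + 1) * p * D ≤ (2 * d) * p * D := by
        gcongr; omega
      have h3 : (2 * d) * (2 * Q.card) ≤ (2 * d) * (D * p) := by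
        calc (2 * d) * (2 * Q.card) = 4 * (d * Q.card) := by ring
          _ ≤ (2 * d) * p * D := h1.trans h2
          _ = _ := by ring
      exact Nat.le_of_mul_le_mul_left h3 (by omega)
    rw [hIcard, mul_add]
    omega
  · -- disconnected case
    unfold ConnIn at hconn
    push Not at hconn
    obtain ⟨A, hAL, hA, hB, hno⟩ := hconn
    obtain ⟨x, hxA⟩ := hA
    obtain ⟨y, hyB⟩ := hB
    obtain ⟨hyL, hyA⟩ := mem_sdiff.1 hyB
    obtain ⟨I, hIA, hI, hIc⟩ := ih A.card
      (by rw [← hn]; exact card_lt_card ⟨hAL, fun h => hyA (h hyL)⟩)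
      A S R j rfl (fun σ hσ => hL σ (hAL hσ)) hS (fun c hc hcA => hj c hc (hcA.trans hAL)) hbd
    obtain ⟨J, hJB, hJ, hJc⟩ := ih (L \ A).card
      (by rw [← hn]; exact card_lt_card ⟨sdiff_subset, fun h => (mem_sdiff.1 (h (hAL hxA))).2 hxA⟩)
      (L \ A) S R j rfl (fun σ hσ => hL σ (mem_sdiff.1 hσ).1) hS
      (fun c hc hcA => hj c hc (hcA.trans sdiff_subset)) hbd
    refine ⟨I ∪ J, union_subset (hIA.trans hAL) (hJB.trans sdiff_subset),
      indep_union (fun c hc hcL ⟨x, hx, hxA⟩ => hno c hc hcL ⟨x, hx, hxA⟩) hAL hIA hJB hI hJ, ?_⟩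
    have hdis : Disjoint I J :=
      Finset.disjoint_left.2 fun i h1 h2 => (mem_sdiff.1 (hJB h2)).2 (hIA h1)
    have hcov : L.filter (fun σ => ¬ facesOf σ ⊆ S) ⊆
        A.filter (fun σ => ¬ facesOf σ ⊆ S) ∪ (L \ A).filter (fun σ => ¬ facesOf σ ⊆ S) := by
      intro σ hσ
      obtain ⟨h1, h2⟩ := mem_filter.1 hσ
      by_cases h : σ ∈ A
      · exact mem_union_left _ (mem_filter.2 ⟨h, h2⟩)
      · exact mem_union_right _ (mem_filter.2 ⟨mem_sdiff.2 ⟨h1, h⟩, h2⟩)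
    have hc1 := (card_le_card hcov).trans (card_union_le _ _)
    rw [card_union_of_disjoint hdis, mul_add]
    omega

end Faces

/-- Let `d ≥ 1`, `k ≥ 1`, and let `K` be a finite simplicial `d`-complex (given by its
finite set of `d`-simplices) whose `d`-simplices support a nontrivial `d`-cycle over a
field `F`.  If `f_d(K) > ((d+1)/2) · k(k+1) · rank_d(K)`, then `K` contains a simple
`d`-cycle of size greater than `k`. -/
theorem exists_large_simple_cycle (F : Type) [Field F] {V : Type} [LinearOrder V]
    (d k : ℕ) (hd : 1 ≤ d) (hk : 1 ≤ k) (K : Finset (Finset V))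
    (hK : ∀ σ ∈ K, σ.card = d + 1)
    (hcyc : ∃ c : (Finset V) →₀ F, IsCycle F d c ∧ c ≠ 0 ∧ c.support ⊆ K)
    (hdense : (((d : ℚ) + 1) / 2) * ((k : ℚ) * ((k : ℚ) + 1)) * (rankBd F K : ℚ) <
      (K.card : ℚ)) :
    ∃ c : (Finset V) →₀ F, IsSimpleCycle F d c ∧ c.support ⊆ K ∧
      k < c.support.card := by
  classical
  by_contra hcon
  push Not at hcon
  set T := Finsupp.linearCombination F (sbdry F (V := V)) with hT
  have hTs : ∀ c : Finset V →₀ F, T c = ∑ σ ∈ c.support, c σ • sbdry F σ := fun c => by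
    rw [hT, Finsupp.linearCombination_apply, Finsupp.sum]
  obtain ⟨I, hIK, hI, hIc⟩ := main_induction (F := F) d k hd hk K.card K ∅ (LinearMap.ker T) k rfl hK
    (by
      intro a ha
      rw [← hT, LinearMap.mem_ker.1 ha]; simp)
    (by
      intro c hc hcK
      refine hcon c ⟨⟨fun σ hσ => hK σ (hcK hσ), ?_⟩, hc.2.1, ?_⟩ hcK
      · rw [← hTs]; exact LinearMap.mem_ker.1 hc.1
      · intro c' hc' hc0 hs
        exact subset_antisymm hs (hc.2.2 c' (LinearMap.mem_ker.2 (by rw [hTs]; exact hc'.2)) hc0 hs))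
    (by simp)
  have hall : K.filter (fun σ => ¬ facesOf σ ⊆ ∅) = K := by
    apply filter_true_of_mem
    intro σ hσ h
    have h1 := card_facesOf σ
    rw [subset_empty.1 h, hK σ hσ] at h1
    simp at h1
  rw [hall] at hIc
  -- `I` is linearly independent
  have hli : LinearIndepOn F (sbdry F) (I : Set (Finset V)) := by
    rw [linearIndepOn_iff]
    intro l hl h0
    exact hI l (LinearMap.mem_ker.2 h0) (by rw [Finsupp.mem_supported] at hl; exact_mod_cast hl)
  have hrank : I.card ≤ rankBd F K := by
    unfold rankBd
    haveI : FiniteDimensional F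
        (Submodule.span F ((fun σ => sbdry F σ) '' (↑K : Set (Finset V)))) :=
      FiniteDimensional.span_of_finite F ((K.finite_toSet).image _)
    have h1 := finrank_span_eq_card (R := F) (b := fun i : I => sbdry F (i : Finset V)) hli
    rw [Fintype.card_coe] at h1
    rw [← h1]
    apply Submodule.finrank_mono
    apply Submodule.span_mono
    rintro _ ⟨i, rfl⟩
    exact ⟨i, hIK i.2, rfl⟩
  have h2 : 2 * K.card ≤ (d + 1) * (k * (k + 1)) * rankBd F K :=
    hIc.trans (Nat.mul_le_mul_left _ hrank)
  have h3 : (2 : ℚ) * K.card ≤ ((d : ℚ) + 1) * ((k : ℚ) * ((k : ℚ) + 1)) * (rankBd F K : ℚ) := by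
    exact_mod_cast h2
  linarith
end

section
/- Fix a field F and an integer d >= 1. Let K be a finite pure simplicial d-complex whose d-simplices support at least one nontrivial d-cycle over F. Then c_d(K) >= sqrt( (2/(d+1)) * f_d(K)/f_{d-1}(K) ) - 1, where c_d(K) is the maximum size of a simple d-cycle of K and f_i(K) is the number of i-simplices of K. -/
open Finset

def Circ {F ι : Type} [Field F] (R : Submodule F (ι →₀ F)) (x : ι →₀ F) : Prop :=
  x ∈ R ∧ x ≠ 0 ∧ ∀ y ∈ R, y ≠ 0 → y.support ⊆ x.support → y.support = x.support

set_option linter.unusedSectionVars false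

section abstractCirc
variable {F ι : Type} [Field F] [DecidableEq ι] {R : Submodule F (ι →₀ F)}

lemma elim_vec (x y : ι →₀ F) (f : ι) (hy : y f ≠ 0) (hx : x ∈ R) (hyR : y ∈ R) :
    ∃ l : F, (x - l • y) ∈ R ∧ (x - l • y) f = 0 ∧ (x f ≠ 0 → l ≠ 0) ∧
      (x - l • y).support ⊆ (x.support ∪ y.support).erase f := by
  refine ⟨x f / y f, R.sub_mem hx (R.smul_mem _ hyR), ?_, ?_, ?_⟩
  · simp [hy]
  · intro h; exact div_ne_zero h hy
  · intro i hi
    simp only [Finsupp.mem_support_iff, Finsupp.coe_sub, Finsupp.coe_smul, Pi.sub_apply,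
      Pi.smul_apply, smul_eq_mul] at hi
    simp only [Finset.mem_erase, Finset.mem_union, Finsupp.mem_support_iff]
    refine ⟨?_, ?_⟩
    · rintro rfl; apply hi; field_simp; simp
    · by_contra! h; apply hi; simp [h.1, h.2]

lemma exists_circ_s12 (n : ℕ) : ∀ (x : ι →₀ F), x.support.card = n → x ∈ R → ∀ e, x e ≠ 0 →
    ∃ y, Circ R y ∧ y e ≠ 0 ∧ y.support ⊆ x.support := by
  induction n using Nat.strong_induction_on with
  | _ n ih =>
  intro x hn hx e he
  by_cases hc : Circ R x
  · exact ⟨x, hc, he, subset_rfl⟩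
  · have hx0 : x ≠ 0 := by rintro rfl; simp at he
    unfold Circ at hc
    push Not at hc
    obtain ⟨y, hyR, hy0, hys, hyne⟩ := hc hx hx0
    have hss : y.support ⊂ x.support := lt_of_le_of_ne hys hyne
    by_cases hye : y e = 0
    · obtain ⟨f, hf⟩ := Finsupp.support_nonempty_iff.mpr hy0
      obtain ⟨l, h1, h2, h3, h4⟩ := elim_vec x y f (Finsupp.mem_support_iff.mp hf) hx hyR
      have h5 : (x - l • y).support ⊂ x.support := by
        rw [Finset.union_eq_left.mpr hys] at h4
        exact lt_of_le_of_lt h4 (Finset.erase_ssubset (hys hf))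
      obtain ⟨z, hz1, hz2, hz3⟩ := ih _ (hn ▸ Finset.card_lt_card h5) _ rfl h1 e (by simp [hye, he])
      exact ⟨z, hz1, hz2, hz3.trans h5.subset⟩
    · obtain ⟨z, hz1, hz2, hz3⟩ := ih _ (hn ▸ Finset.card_lt_card hss) y rfl hyR e hye
      exact ⟨z, hz1, hz2, hz3.trans hys⟩

lemma exists_circ' {x : ι →₀ F} (hx : x ∈ R) {e : ι} (he : x e ≠ 0) :
    ∃ y, Circ R y ∧ y e ≠ 0 ∧ y.support ⊆ x.support :=
  exists_circ_s12 _ x rfl hx e he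

/-- a relation strictly inside a circuit vanishes -/
lemma Circ.eq_zero {x : ι →₀ F} (hx : Circ R x) {y : ι →₀ F} (hy : y ∈ R)
    (hs : y.support ⊆ x.support) {f : ι} (hf : x f ≠ 0) (hyf : y f = 0) : y = 0 := by
  by_contra h
  have := hx.2.2 y hy h hs
  have h2 : f ∈ y.support := this ▸ Finsupp.mem_support_iff.mpr hf
  exact Finsupp.mem_support_iff.mp h2 hyf

lemma Circ.exists_ne {x : ι →₀ F} (hx : Circ R x) : ∃ f, x f ≠ 0 := by
  obtain ⟨f, hf⟩ := Finsupp.support_nonempty_iff.mpr hx.2.1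
  exact ⟨f, Finsupp.mem_support_iff.mp hf⟩

lemma Circ.prop {x : ι →₀ F} (hx : Circ R x) {y : ι →₀ F} (hy : y ∈ R)
    (hs : y.support ⊆ x.support) : ∃ l : F, y = l • x := by
  obtain ⟨f, hf⟩ := hx.exists_ne
  obtain ⟨l, h1, h2, h3, h4⟩ := elim_vec y x f hf hy hx.1
  refine ⟨l, sub_eq_zero.mp (hx.eq_zero h1 ?_ hf h2)⟩
  exact h4.trans ((Finset.erase_subset _ _).trans (Finset.union_subset hs subset_rfl))

lemma circ_trans_s12 (n : ℕ) : ∀ (x y : ι →₀ F), (x.support ∪ y.support).card = n →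
    Circ R x → Circ R y → ∀ f e g, x f ≠ 0 → y f ≠ 0 → x e ≠ 0 → y g ≠ 0 →
    ∃ z, Circ R z ∧ z e ≠ 0 ∧ z g ≠ 0 ∧ z.support ⊆ x.support ∪ y.support := by
  induction n using Nat.strong_induction_on with
  | _ n ih =>
  intro x y hn hx hy f e g hxf hyf hxe hyg
  by_cases hye : y e ≠ 0
  · exact ⟨y, hy, hye, hyg, Finset.subset_union_right⟩
  by_cases hxg : x g ≠ 0
  · exact ⟨x, hx, hxe, hxg, Finset.subset_union_left⟩
  push Not at hye hxg
  obtain ⟨l, a1, a2, a3, a4⟩ := elim_vec x y f hyf hx.1 hy.1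
  obtain ⟨p, hp, hpe, hps⟩ := exists_circ' a1 (e := e) (by simp [hye, hxe])
  obtain ⟨m, b1, b2, b3, b4⟩ := elim_vec y x f hxf hy.1 hx.1
  obtain ⟨q, hq, hqg, hqs⟩ := exists_circ' b1 (e := g) (by simp [hxg, hyg])
  replace hps := hps.trans a4
  replace hqs := hqs.trans b4
  rw [Finset.union_comm] at hqs
  have hps' := hps.trans (Finset.erase_subset _ _)
  have hqs' := hqs.trans (Finset.erase_subset _ _)
  have hfu : f ∈ x.support ∪ y.support := by simp [hxf]
  have hpf : p f = 0 := by
    by_contra h; simpa using hps (Finsupp.mem_support_iff.mpr h)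
  have hqf : q f = 0 := by
    by_contra h; simpa using hqs (Finsupp.mem_support_iff.mpr h)
  -- p meets supp y
  have hpy : ∃ i, p i ≠ 0 ∧ y i ≠ 0 := by
    by_contra! h
    refine hp.2.1 (hx.eq_zero hp.1 ?_ hxf hpf)
    intro i hi
    have := hps' hi
    rw [Finset.mem_union] at this
    rcases this with h1 | h1
    · exact h1
    · exact absurd (h i (by simpa using hi)) (by simpa using h1)
  have hqx : ∃ i, q i ≠ 0 ∧ y i = 0 := by
    by_contra! h
    refine hq.2.1 (hy.eq_zero hq.1 ?_ hyf hqf)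
    intro i hi
    simpa using h i (by simpa using hi)
  obtain ⟨i, hpi, hyi⟩ := hpy
  obtain ⟨j, hqj, hyj⟩ := hqx
  by_cases hpj : p j ≠ 0
  · have hu : p.support ∪ q.support ⊂ x.support ∪ y.support :=
      lt_of_le_of_lt (Finset.union_subset hps hqs) (Finset.erase_ssubset hfu)
    obtain ⟨z, h1, h2, h3, h4⟩ := ih _ (hn ▸ Finset.card_lt_card hu) p q rfl hp hq j e g hpj hqj hpe hqg
    exact ⟨z, h1, h2, h3, h4.trans hu.subset⟩
  · push Not at hpj
    have hu : p.support ∪ y.support ⊂ x.support ∪ y.support := by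
      refine Finset.ssubset_iff_of_subset (Finset.union_subset hps' Finset.subset_union_right) |>.mpr ?_
      refine ⟨j, hqs' (by simpa using hqj), by simp [hpj, hyj]⟩
    obtain ⟨z, h1, h2, h3, h4⟩ := ih _ (hn ▸ Finset.card_lt_card hu) p y rfl hp hy i e g hpi hyi hpe hyg
    exact ⟨z, h1, h2, h3, h4.trans hu.subset⟩

/-- `E` has no nontrivial separation. -/
def Conn (R : Submodule F (ι →₀ F)) (E : Finset ι) : Prop :=
  ∀ A ⊆ E, A.Nonempty → A ≠ E → ∃ y ∈ R, y.support ⊆ E ∧ y.filter (· ∈ A) ∉ R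

lemma filter_mem (E A : Finset ι)
    (hA : ∀ z, Circ R z → z.support ⊆ E → (∃ i ∈ A, z i ≠ 0) → z.support ⊆ A) (n : ℕ) :
    ∀ y : ι →₀ F, y.support.card = n → y ∈ R → y.support ⊆ E → y.filter (· ∈ A) ∈ R := by
  induction n using Nat.strong_induction_on with
  | _ n ih =>
  intro y hn hy hyE
  by_cases h0 : ∀ i ∈ A, y i = 0
  · have : y.filter (· ∈ A) = 0 := by
      ext i; simp [Finsupp.filter_apply]; exact h0 i
    rw [this]; exact R.zero_mem
  push Not at h0
  obtain ⟨i, hiA, hyi⟩ := h0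
  obtain ⟨z, hz, hzi, hzs⟩ := exists_circ' hy hyi
  have hzA := hA z hz (hzs.trans hyE) ⟨i, hiA, hzi⟩
  obtain ⟨l, h1, h2, h3, h4⟩ := elim_vec y z i hzi hy hz.1
  rw [Finset.union_eq_left.mpr hzs] at h4
  have h5 : (y - l • z).support ⊂ y.support :=
    lt_of_le_of_lt h4 (Finset.erase_ssubset (by simpa using hyi))
  have h6 := ih _ (hn ▸ Finset.card_lt_card h5) _ rfl h1 (h5.subset.trans hyE)
  have h7 : y.filter (· ∈ A) = (y - l • z).filter (· ∈ A) + l • z := by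
    ext j
    by_cases hj : j ∈ A
    · simp [hj]
    · have : z j = 0 := by
        by_contra h; exact hj (hzA (by simpa using h))
      simp [hj, this]
  rw [h7]; exact R.add_mem h6 (R.smul_mem _ hz.1)

lemma conn_circ_s12 {E : Finset ι} (hE : Conn R E) {x : ι →₀ F} (hx : Circ R x)
    (hxE : x.support ⊆ E) {e g : ι} (he : x e ≠ 0) (hg : g ∈ E) :
    ∃ z, Circ R z ∧ z.support ⊆ E ∧ z e ≠ 0 ∧ z g ≠ 0 := by
  classical
  set A := E.filter (fun g => ∃ z, Circ R z ∧ z.support ⊆ E ∧ z e ≠ 0 ∧ z g ≠ 0) with hA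
  by_cases hAE : A = E
  · rw [← hAE, hA, Finset.mem_filter] at hg
    exact hg.2
  exfalso
  have heE : e ∈ E := hxE (by simpa using he)
  obtain ⟨y, hy, hyE, hn⟩ := hE A (Finset.filter_subset _ _)
    ⟨e, by rw [hA, Finset.mem_filter]; exact ⟨heE, x, hx, hxE, he, he⟩⟩ hAE
  refine hn (filter_mem E A ?_ _ y rfl hy hyE)
  rintro z hz hzE ⟨i, hi, hzi⟩ j hj
  rw [hA, Finset.mem_filter] at hi ⊢
  obtain ⟨_, w, hw, hwE, hwe, hwi⟩ := hi
  refine ⟨hzE hj, ?_⟩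
  obtain ⟨u, h1, h2, h3, h4⟩ := circ_trans_s12 _ w z rfl hw hz i e j hwi hzi hwe (by simpa using hj)
  exact ⟨u, h1, h4.trans (Finset.union_subset hwE hzE), h2, h3⟩

/-- choose a translate along a circuit killing between 1 and half of the coordinates -/
lemma choose_t {x w : ι →₀ F} (hx : x ≠ 0) (hw : ∀ t : F, ∃ i, x i ≠ 0 ∧ (w + t • x) i ≠ 0) :
    ∃ t : F, (∃ i, x i ≠ 0 ∧ (w + t • x) i = 0) ∧
      x.support.card ≤ 2 * (x.support ∩ (w + t • x).support).card := by
  obtain ⟨i, hi⟩ := Finsupp.support_nonempty_iff.mpr hx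
  rw [Finsupp.mem_support_iff] at hi
  obtain ⟨j, hj, hj'⟩ := hw (-(w i / x i))
  have e1 : (w + (-(w i / x i)) • x) i = 0 := by simp [hi]
  have e2 : (w + (-(w j / x j)) • x) j = 0 := by simp [hj]
  have hc : x.support.card ≤ (x.support ∩ (w + (-(w i / x i)) • x).support).card
      + (x.support ∩ (w + (-(w j / x j)) • x).support).card := by
    refine le_trans (Finset.card_le_card ?_) (Finset.card_union_le _ _)
    intro k hk
    have hk' := Finsupp.mem_support_iff.mp hk
    simp only [Finset.mem_union, Finset.mem_inter, hk, true_and]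
    by_contra! h
    obtain ⟨ha, hb⟩ := h
    rw [Finsupp.notMem_support_iff] at ha hb
    apply hj'
    simp only [Finsupp.coe_add, Finsupp.coe_smul, Pi.add_apply, Pi.smul_apply, smul_eq_mul] at ha hb ⊢
    have : w i / x i = w j / x j := by
      have h3 : (w i / x i - w j / x j) * x k = 0 := by linear_combination hb - ha
      rcases mul_eq_zero.mp h3 with h | h
      · exact sub_eq_zero.mp h
      · exact absurd h hk'
    rw [this]; field_simp; simp
  by_cases h : x.support.card ≤ 2 * (x.support ∩ (w + (-(w i / x i)) • x).support).card
  · exact ⟨_, ⟨i, hi, e1⟩, h⟩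
  · exact ⟨_, ⟨j, hj, e2⟩, by omega⟩

lemma no_one {x y w : ι →₀ F} (hw : Circ R w) {c₀ : ι} (hw0 : w c₀ ≠ 0) (hx0 : x c₀ ≠ 0)
    (hmin : ∀ q, Circ R q → (∀ i, q i ≠ 0 → w i ≠ 0 ∨ x i ≠ 0 ∨ y i ≠ 0) →
      (∃ i, q i ≠ 0 ∧ x i ≠ 0) → (∃ i, q i ≠ 0 ∧ y i ≠ 0) →
      ∀ z, w z ≠ 0 → x z = 0 → y z = 0 → q z ≠ 0)
    {q : ι →₀ F} (hq : Circ R q) (hqs : ∀ i, q i ≠ 0 → w i ≠ 0 ∨ x i ≠ 0 ∨ y i ≠ 0)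
    (hqx : ∀ i, x i ≠ 0 → q i = 0) {z : ι} (hqz : q z ≠ 0) (hwz : w z ≠ 0) (hxz : x z = 0)
    (hyz : y z = 0) : False := by
  obtain ⟨l, h1, h2, h3, h4⟩ := elim_vec w q z hqz hw.1 hq.1
  obtain ⟨p, hp, hp0, hps⟩ := exists_circ' h1 (e := c₀) (by simp [hqx c₀ hx0, hw0])
  have hps' : ∀ i, p i ≠ 0 → i ≠ z ∧ (w i ≠ 0 ∨ q i ≠ 0) := by
    intro i hi
    simpa using h4 (hps (Finsupp.mem_support_iff.mpr hi))
  have hpz : p z = 0 := by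
    by_contra h; exact (hps' z h).1 rfl
  have hpy : ∀ i, p i ≠ 0 → y i = 0 := by
    by_contra! h
    refine hmin p hp ?_ ⟨c₀, hp0, hx0⟩ h z hwz hxz hyz hpz
    intro i hi
    rcases (hps' i hi).2 with h | h
    · exact Or.inl h
    · exact hqs i h
  refine hp.2.1 (hw.eq_zero hp.1 ?_ hwz hpz)
  intro i hi
  rw [Finsupp.mem_support_iff] at hi ⊢
  rcases (hps' i hi).2 with h | h
  · exact h
  · rcases hqs i h with h' | h' | h'
    · exact h'
    · exact absurd (hqx i h') h
    · exact absurd (hpy i hi) h'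

lemma big_circ {x y w : ι →₀ F} (hx : Circ R x) (hy : Circ R y) (hw : Circ R w)
    (hdis : ∀ i, x i ≠ 0 → y i = 0)
    (hskew : ∀ z ∈ R, (∀ i, z i ≠ 0 → x i ≠ 0 ∨ y i ≠ 0) → ∃ a b : F, z = a • x + b • y)
    {c₀ c₁ : ι} (hw0 : w c₀ ≠ 0) (hx0 : x c₀ ≠ 0) (hw1 : w c₁ ≠ 0) (hy1 : y c₁ ≠ 0)
    (hmin : ∀ q, Circ R q → (∀ i, q i ≠ 0 → w i ≠ 0 ∨ x i ≠ 0 ∨ y i ≠ 0) →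
      (∃ i, q i ≠ 0 ∧ x i ≠ 0) → (∃ i, q i ≠ 0 ∧ y i ≠ 0) →
      ∀ z, w z ≠ 0 → x z = 0 → y z = 0 → q z ≠ 0) :
    ∃ u, Circ R u ∧ (∀ i, u i ≠ 0 → w i ≠ 0 ∨ x i ≠ 0 ∨ y i ≠ 0) ∧
      x.support.card + y.support.card < 2 * u.support.card := by
  have hdis' : ∀ i, y i ≠ 0 → x i = 0 := fun i hi => by
    by_contra h; exact hi (hdis i h)
  -- Z nonempty
  have hZ : ∃ z, w z ≠ 0 ∧ x z = 0 ∧ y z = 0 := by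
    by_contra! h
    obtain ⟨a, b, hab⟩ := hskew w hw.1 (fun i hi => by
      by_cases hxi : x i = 0
      · exact Or.inr (h i hi hxi)
      · exact Or.inl hxi)
    have ha : a ≠ 0 := by
      rintro rfl; rw [hab] at hw0; simp [hdis c₀ hx0] at hw0
    have hxw : x.support ⊆ w.support := by
      intro i hi
      rw [Finsupp.mem_support_iff] at hi ⊢
      rw [hab]; simp [hdis i hi, ha, hi]
    exact hx.2.1 (hw.eq_zero hx.1 hxw hw1 (hdis' _ hy1))
  obtain ⟨z, hwz, hxz, hyz⟩ := hZ
  obtain ⟨t, ⟨i₀, hi0, hi0'⟩, ht⟩ := choose_t (w := w) hx.2.1 (by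
    intro t
    by_contra! h
    have h0 : w + t • x = 0 := by
      refine hw.eq_zero (R.add_mem hw.1 (R.smul_mem _ hx.1)) ?_ hw0 (h c₀ hx0)
      intro i hi
      rw [Finsupp.mem_support_iff] at hi ⊢
      have hxi : x i = 0 := by
        by_contra hxi; exact hi (h i hxi)
      simpa [hxi] using hi
    have := DFunLike.congr_fun h0 z
    simp [hxz, hwz] at this)
  obtain ⟨s, ⟨j₀, hj0, hj0'⟩, hs⟩ := choose_t (w := w) hy.2.1 (by
    intro t
    by_contra! h
    have h0 : w + t • y = 0 := by
      refine hw.eq_zero (R.add_mem hw.1 (R.smul_mem _ hy.1)) ?_ hw1 (h c₁ hy1)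
      intro i hi
      rw [Finsupp.mem_support_iff] at hi ⊢
      have hxi : y i = 0 := by
        by_contra hxi; exact hi (h i hxi)
      simpa [hxi] using hi
    have := DFunLike.congr_fun h0 z
    simp [hyz, hwz] at this)
  set u := w + t • x + s • y with hu
  have huR : u ∈ R := R.add_mem (R.add_mem hw.1 (R.smul_mem _ hx.1)) (R.smul_mem _ hy.1)
  have hui : u i₀ = 0 := by
    have := hdis i₀ hi0
    simp only [hu, Finsupp.add_apply, Finsupp.smul_apply, this] at hi0' ⊢
    rw [hi0']; simp
  have huj : u j₀ = 0 := by
    have := hdis' j₀ hj0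
    simp only [hu, Finsupp.add_apply, Finsupp.smul_apply, this, smul_zero, add_zero] at hj0' ⊢
    exact hj0'
  have huZ : ∀ i, x i = 0 → y i = 0 → u i = w i := by
    intro i h1 h2; simp [hu, h1, h2]
  have hus : ∀ i, u i ≠ 0 → w i ≠ 0 ∨ x i ≠ 0 ∨ y i ≠ 0 := by
    intro i hi
    by_contra! h
    apply hi; rw [huZ i h.2.1 h.2.2, h.1]
  have huz : u z ≠ 0 := by rw [huZ z hxz hyz]; exact hwz
  -- relation inside u vanishing on Z vanishes
  have hvan : ∀ r ∈ R, (∀ i, r i ≠ 0 → u i ≠ 0) → (∀ i, x i = 0 → y i = 0 → r i = 0) → r = 0 := by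
    intro r hr hru hrZ
    obtain ⟨a, b, hab⟩ := hskew r hr (fun i hi => by
      by_contra! h; exact hi (hrZ i h.1 h.2))
    have ha : a = 0 := by
      have : r i₀ = 0 := by
        by_contra h; exact hru _ h hui
      rw [hab] at this; simpa [hdis i₀ hi0, hi0] using this
    have hb : b = 0 := by
      have : r j₀ = 0 := by
        by_contra h; exact hru _ h huj
      rw [hab] at this; simpa [hdis' j₀ hj0, hj0] using this
    rw [hab, ha, hb]; simp
  -- every circuit inside u meeting Z contains Z
  have hcon : ∀ q, Circ R q → (∀ i, q i ≠ 0 → u i ≠ 0) → ∀ z', q z' ≠ 0 → x z' = 0 → y z' = 0 →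
      q z ≠ 0 := by
    intro q hq hqu z' hqz hxz' hyz'
    have hqs : ∀ i, q i ≠ 0 → w i ≠ 0 ∨ x i ≠ 0 ∨ y i ≠ 0 := fun i hi => hus i (hqu i hi)
    have hwz' : w z' ≠ 0 := by
      have := hqu z' hqz; rwa [huZ z' hxz' hyz'] at this
    refine hmin q hq hqs ?_ ?_ z hwz hxz hyz
    · by_contra! h
      exact no_one hw hw0 hx0 hmin hq hqs (fun i hi => by
        by_contra h'; exact hi (h i h')) hqz hwz' hxz' hyz'
    · by_contra! h
      exact no_one (x := y) (y := x) hw hw1 hy1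
        (fun q h1 h2 h3 h4 z h5 h6 h7 => hmin q h1 (fun i hi => (h2 i hi).imp_right Or.symm) h4 h3 z h5 h7 h6)
        hq (fun i hi => (hqs i hi).imp_right Or.symm) (fun i hi => by
        by_contra h'; exact hi (h i h')) hqz hwz' hyz' hxz'
  have huC : Circ R u := by
    obtain ⟨q, hq, hqz, hqs⟩ := exists_circ' huR huz
    have hqu : ∀ i, q i ≠ 0 → u i ≠ 0 := fun i hi => by
      simpa using hqs (Finsupp.mem_support_iff.mpr hi)
    obtain ⟨l, h1, h2, h3, h4⟩ := elim_vec u q z hqz huR hq.1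
    rw [Finset.union_eq_left.mpr hqs] at h4
    have h4' : ∀ i, (u - l • q) i ≠ 0 → i ≠ z ∧ u i ≠ 0 := fun i hi => by
      simpa using h4 (Finsupp.mem_support_iff.mpr hi)
    have h0 : u - l • q = 0 := by
      refine hvan _ h1 (fun i hi => (h4' i hi).2) ?_
      intro i hxi hyi
      by_contra hne
      obtain ⟨p, hp, hpi, hps⟩ := exists_circ' h1 hne
      have hps' : ∀ j, p j ≠ 0 → j ≠ z ∧ u j ≠ 0 := fun j hj => by
        apply h4'; simpa using hps (Finsupp.mem_support_iff.mpr hj)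
      exact (hps' z (hcon p hp (fun j hj => (hps' j hj).2) i hpi hxi hyi)).1 rfl
    have hl : l ≠ 0 := h3 huz
    have huq : u = l • q := sub_eq_zero.mp h0
    have hsupp : u.support = q.support := by
      rw [huq]; exact Finsupp.support_smul_eq hl
    refine ⟨huR, ?_, ?_⟩
    · rintro h; rw [h] at huz; simp at huz
    · rw [hsupp]; exact hq.2.2
  refine ⟨u, huC, hus, ?_⟩
  have k1 : x.support ∩ (w + t • x).support ⊆ u.support := by
    intro i hi
    simp only [Finset.mem_inter, Finsupp.mem_support_iff] at hi ⊢
    simpa [hu, hdis i hi.1] using hi.2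
  have k2 : y.support ∩ (w + s • y).support ⊆ u.support := by
    intro i hi
    simp only [Finset.mem_inter, Finsupp.mem_support_iff] at hi ⊢
    simpa [hu, hdis' i hi.1] using hi.2
  have k3 : Disjoint (x.support ∩ (w + t • x).support) (y.support ∩ (w + s • y).support) := by
    rw [Finset.disjoint_left]
    intro i hi hi'
    simp only [Finset.mem_inter, Finsupp.mem_support_iff] at hi hi'
    exact hi'.1 (hdis i hi.1)
  have k4 : (x.support ∩ (w + t • x).support) ∪ (y.support ∩ (w + s • y).support) ⊂ u.support := by
    refine (Finset.ssubset_iff_of_subset (Finset.union_subset k1 k2)).mpr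
      ⟨z, by simpa using huz, by simp [hxz, hyz]⟩
  have k5 := Finset.card_lt_card k4
  rw [Finset.card_union_of_disjoint k3] at k5
  omega

/-- Contracting a largest circuit of a connected `E` strictly decreases circuit sizes. -/
lemma contract_lt {E : Finset ι} (hE : Conn R E) {x : ι →₀ F} (hx : Circ R x)
    (hxE : x.support ⊆ E)
    (hmax : ∀ q, Circ R q → q.support ⊆ E → q.support.card ≤ x.support.card)
    {y : ι →₀ F} (hy : Circ (R ⊔ Finsupp.supported F F (x.support : Set ι)) y)
    (hyE : y.support ⊆ E) (hyx : ∀ i, y i ≠ 0 → x i = 0) :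
    y.support.card < x.support.card := by
  classical
  by_contra! hcard
  set R' := R ⊔ Finsupp.supported F F (x.support : Set ι) with hR'
  have hfil : ∀ r ∈ R, r.filter (fun i => x i = 0) ∈ R' := by
    intro r hr
    have : r.filter (fun i => x i = 0) = r - r.filter (fun i => ¬ x i = 0) := by
      rw [eq_sub_iff_add_eq]; exact Finsupp.filter_add_filter_not r _
    rw [this]
    refine R'.sub_mem (Submodule.mem_sup_left hr) (Submodule.mem_sup_right ?_)
    rw [Finsupp.mem_supported]
    intro i hi
    simp at hi ⊢
    exact hi.2
  obtain ⟨f, hyf⟩ := hy.exists_ne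
  obtain ⟨r, hr, s, hs, hrs⟩ := Submodule.mem_sup.mp hy.1
  rw [Finsupp.mem_supported] at hs
  have hs' : ∀ i, x i = 0 → s i = 0 := by
    intro i hi
    by_contra h
    exact (Finsupp.mem_support_iff.mp (hs (Finsupp.mem_support_iff.mpr h))) hi
  have hry : ∀ i, x i = 0 → r i = y i := by
    intro i hi; rw [← hrs]; simp [hs' i hi]
  obtain ⟨p, hp, hpf, hps⟩ := exists_circ' hr (e := f) (by rw [hry f (hyx f hyf)]; exact hyf)
  have hps' : ∀ i, p i ≠ 0 → r i ≠ 0 := fun i hi => by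
    simpa using hps (Finsupp.mem_support_iff.mpr hi)
  have hpE : p.support ⊆ E := by
    intro i hi
    have hi' := hps' i (by simpa using hi)
    by_cases hxi : x i = 0
    · rw [hry i hxi] at hi'; exact hyE (by simpa using hi')
    · exact hxE (by simpa using hxi)
  -- relations of R outside x supported in y
  have hsub : y.support ⊆ p.support := by
    have := hy.2.2 (p.filter (fun i => x i = 0)) (hfil p hp.1) (by
      intro h
      have := DFunLike.congr_fun h f
      simp [hyx f hyf, hpf] at this) (by
      intro i hi
      simp at hi ⊢
      rw [← hry i hi.2]; exact hps' i hi.1)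
    rw [← this]
    intro i hi
    simp at hi ⊢
    exact hi.1
  have hpy : y.support = p.support :=
    Finset.eq_of_subset_of_card_le hsub ((hmax p hp hpE).trans hcard)
  have hpy' : ∀ i, p i ≠ 0 ↔ y i ≠ 0 := fun i => by
    rw [← Finsupp.mem_support_iff, ← Finsupp.mem_support_iff, hpy]
  have hdis : ∀ i, x i ≠ 0 → p i = 0 := by
    intro i hi
    by_contra h; exact hi (hyx i ((hpy' i).mp h))
  have hskew : ∀ z ∈ R, (∀ i, z i ≠ 0 → x i ≠ 0 ∨ p i ≠ 0) → ∃ a b : F, z = a • x + b • p := by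
    intro z hz hzs
    obtain ⟨l, h1, h2, h3, h4⟩ := elim_vec z p f hpf hz hp.1
    have h0 : (z - l • p).filter (fun i => x i = 0) = 0 := by
      refine hy.eq_zero (hfil _ h1) ?_ hyf ?_
      · intro i hi
        simp only [Finsupp.support_filter, Finset.mem_filter] at hi
        have := h4 hi.1
        simp only [Finset.mem_erase, Finset.mem_union, Finsupp.mem_support_iff] at this
        rw [Finsupp.mem_support_iff, ← hpy' i]
        rcases this.2 with h | h
        · exact (hzs i h).resolve_left (by simpa using hi.2)
        · exact h
      · rw [Finsupp.filter_apply, h2]; simp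
    obtain ⟨a, ha⟩ := hx.prop h1 (by
      intro i hi
      rw [Finsupp.mem_support_iff] at hi ⊢
      intro hxi
      have := DFunLike.congr_fun h0 i
      rw [Finsupp.filter_apply, if_pos hxi] at this
      exact hi this)
    exact ⟨a, l, by rw [← ha]; simp⟩
  -- minimal connecting circuit
  obtain ⟨c₀, hc0⟩ := hx.exists_ne
  let P : ℕ → Prop := fun n => ∃ w, Circ R w ∧ w.support ⊆ E ∧ (∃ i, w i ≠ 0 ∧ x i ≠ 0) ∧
    (∃ i, w i ≠ 0 ∧ p i ≠ 0) ∧ (w.support \ (x.support ∪ p.support)).card = n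
  have hP : ∃ n, P n := by
    obtain ⟨w, h1, h2, h3, h4⟩ := conn_circ_s12 hE hx hxE hc0 (hpE (Finsupp.mem_support_iff.mpr hpf))
    exact ⟨_, w, h1, h2, ⟨c₀, h3, hc0⟩, ⟨f, h4, hpf⟩, rfl⟩
  obtain ⟨w, hw, hwE, ⟨i₀, hw0, hx0⟩, ⟨j₀, hw1, hp1⟩, hwn⟩ := Nat.find_spec hP
  have hsE : ∀ q : ι →₀ F, (∀ i, q i ≠ 0 → w i ≠ 0 ∨ x i ≠ 0 ∨ p i ≠ 0) → q.support ⊆ E := by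
    intro q hq i hi
    rcases hq i (by simpa using hi) with h | h | h
    · exact hwE (by simpa using h)
    · exact hxE (by simpa using h)
    · exact hpE (by simpa using h)
  obtain ⟨u, hu, hus, hcu⟩ := big_circ hx hp hw hdis hskew hw0 hx0 hw1 hp1 (by
    intro q hq hqs hqx hqp z hwz hxz hpz hqz
    have hlt : (q.support \ (x.support ∪ p.support)).card < Nat.find hP := by
      rw [← hwn]
      apply Finset.card_lt_card
      refine (Finset.ssubset_iff_of_subset ?_).mpr ⟨z, by simp [hwz, hxz, hpz], by simp [hqz]⟩
      intro i hi
      simp only [Finset.mem_sdiff, Finset.mem_union, Finsupp.mem_support_iff, not_or] at hi ⊢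
      refine ⟨?_, hi.2⟩
      rcases hqs i hi.1 with h | h | h
      · exact h
      · exact absurd h hi.2.1
      · exact absurd h hi.2.2
    exact Nat.find_min hP hlt ⟨q, hq, hsE q hqs, hqx, hqp, rfl⟩)
  have := hmax u hu (hsE u hus)
  rw [← hpy] at hcu
  omega

end abstractCirc

section complexes
variable {F : Type} [Field F] {V : Type} [LinearOrder V]

lemma sbdry_apply_ne {d : ℕ} {σ : Finset V} (hσ : σ.card = d + 1) (τ : Finset V) :
    sbdry F σ τ ≠ 0 ↔ τ ∈ σ.powersetCard d := by
  have hs : sbdry F σ τ = ∑ v ∈ σ, ((-1 : F) ^ ((σ.filter (fun w => w < v)).card)) *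
      (if σ.erase v = τ then 1 else 0) := by
    simp [sbdry, Finsupp.single_apply]
  constructor
  · intro h
    rw [hs] at h
    obtain ⟨v, hv, hne⟩ := Finset.exists_ne_zero_of_sum_ne_zero h
    have : σ.erase v = τ := by
      by_contra h'; simp [h'] at hne
    rw [← this, Finset.mem_powersetCard]
    exact ⟨Finset.erase_subset _ _, by rw [Finset.card_erase_of_mem hv, hσ]; rfl⟩
  · intro h
    rw [Finset.mem_powersetCard] at h
    obtain ⟨v, hv⟩ : ∃ v, σ \ τ = {v} := by
      rw [← Finset.card_eq_one, Finset.card_sdiff_of_subset h.1]; omega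
    have hvm : v ∈ σ ∧ v ∉ τ := by
      rw [← Finset.mem_sdiff, hv]; simp
    have hτ : σ.erase v = τ := by
      rw [Finset.erase_eq, ← hv, Finset.sdiff_sdiff_eq_self h.1]
    rw [hs, Finset.sum_eq_single v]
    · simp [hτ]
    · intro w hw hne
      have : σ.erase w ≠ τ := by
        intro h'
        apply hvm.2; rw [← h']; simp [hvm.1, hne.symm]
      simp [this]
    · intro h; exact absurd hvm.1 h

lemma deg_bound {d : ℕ} (A N : Finset (Finset V)) (τ : Finset V)
    (hA : ∀ σ ∈ A, σ.card = d + 1 ∧ τ ∈ σ.powersetCard d ∧ σ.powersetCard d ⊆ N) :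
    d * A.card ≤ N.card := by
  have h1 : (A.biUnion fun σ => (σ.powersetCard d).erase τ).card = d * A.card := by
    rw [Finset.card_biUnion]
    · rw [Finset.sum_congr rfl (g := fun _ => d)]
      · simp [mul_comm]
      · intro σ hσ
        rw [Finset.card_erase_of_mem (hA σ hσ).2.1, Finset.card_powersetCard, (hA σ hσ).1]
        simp
    · intro σ hσ σ' hσ' hne
      refine Finset.disjoint_left.mpr ?_
      intro ρ hρ hρ'
      apply hne
      rw [Finset.mem_erase, Finset.mem_powersetCard] at hρ hρ'
      have key : ∀ σ ∈ A, ρ ⊆ σ → τ ∪ ρ = σ := by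
        intro σ hσ hs
        obtain ⟨k1, k2, -⟩ := hA σ hσ
        rw [Finset.mem_powersetCard] at k2
        refine Finset.eq_of_subset_of_card_le (Finset.union_subset k2.1 hs) ?_
        rw [k1]
        have : τ ⊂ τ ∪ ρ := by
          refine lt_of_le_of_ne Finset.subset_union_left ?_
          intro h
          apply hρ.1
          refine Finset.eq_of_subset_of_card_le ?_ (by rw [k2.2, hρ.2.2])
          rw [h]; exact Finset.subset_union_right
        have := Finset.card_lt_card this
        omega
      rw [← key σ hσ hρ.2.1, ← key σ' hσ' hρ'.2.1]
  rw [← h1]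
  apply Finset.card_le_card
  intro ρ hρ
  rw [Finset.mem_biUnion] at hρ
  obtain ⟨σ, hσ, hρ⟩ := hρ
  exact (hA σ hσ).2.2 (Finset.mem_of_mem_erase hρ)

lemma lc_apply (r : Finset V →₀ F) (τ : Finset V) :
    (Finsupp.linearCombination F (sbdry F) r) τ = ∑ σ ∈ r.support, r σ * sbdry F σ τ := by
  simp [Finsupp.linearCombination_apply, Finsupp.sum, Finsupp.finsetSum_apply]

/-- faces outside `N` of a relation modulo `N` occur at least twice -/
lemma two_le_deg {d : ℕ} {x : Finset V →₀ F} (hx : ∀ σ ∈ x.support, σ.card = d + 1) {τ : Finset V}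
    (h : (Finsupp.linearCombination F (sbdry F) x) τ = 0) {σ : Finset V} (hσ : σ ∈ x.support)
    (hτ : τ ∈ σ.powersetCard d) :
    2 ≤ (x.support.filter (fun σ => τ ∈ σ.powersetCard d)).card := by
  by_contra! hlt
  have hmem : σ ∈ x.support.filter (fun σ => τ ∈ σ.powersetCard d) :=
    Finset.mem_filter.mpr ⟨hσ, hτ⟩
  rw [lc_apply, Finset.sum_eq_single σ] at h
  · rcases mul_eq_zero.mp h with h | h
    · exact Finsupp.mem_support_iff.mp hσ h
    · exact (sbdry_apply_ne (hx σ hσ) τ).mpr hτ h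
  · intro ρ hρ hne
    by_contra h0
    have h1 : τ ∈ ρ.powersetCard d :=
      (sbdry_apply_ne (hx ρ hρ) τ).mp (fun h => h0 (by rw [h, mul_zero]))
    have h2 : ρ ∈ x.support.filter (fun σ => τ ∈ σ.powersetCard d) :=
      Finset.mem_filter.mpr ⟨hρ, h1⟩
    exact hne (Finset.card_le_one.mp (by omega) _ h2 _ hmem)
  · intro h; exact absurd hσ h

lemma new_faces {d : ℕ} {x : Finset V →₀ F} (hx : ∀ σ ∈ x.support, σ.card = d + 1)
    (M : Finset (Finset V)) (hM : M ⊆ x.support.biUnion fun σ => σ.powersetCard d)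
    (h : ∀ τ ∈ M, (Finsupp.linearCombination F (sbdry F) x) τ = 0) :
    2 * M.card ≤ (d + 1) * x.support.card := by
  have := Finset.card_nsmul_le_card_nsmul (s := M) (t := x.support) (R := ℕ)
    (fun (τ σ : Finset V) => τ ∈ σ.powersetCard d) (m := 2) (n := d + 1) ?_ ?_
  · simp only [smul_eq_mul] at this; linarith
  · intro τ hτ
    obtain ⟨σ, hσ, hτσ⟩ := Finset.mem_biUnion.mp (hM hτ)
    exact two_le_deg hx (h τ hτ) hσ hτσ
  · intro σ hσ
    have : (Finset.bipartiteBelow (fun (τ σ : Finset V) => τ ∈ σ.powersetCard d) M σ) ⊆ σ.powersetCard d := by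
      intro τ hτ
      exact (Finset.mem_filter.mp hτ).2
    have := Finset.card_le_card this
    rw [Finset.card_powersetCard, hx σ hσ, Nat.choose_succ_self_right] at this
    exact_mod_cast this

lemma main_ind (d : ℕ) (hd : 1 ≤ d) (c : ℕ) (hc : 1 ≤ c) (n : ℕ) :
    ∀ (E N : Finset (Finset V)) (R : Submodule F (Finset V →₀ F)) (k : ℕ), E.card = n →
    (∀ σ ∈ E, σ.card = d + 1) →
    (∀ r ∈ R, ∀ τ, τ ∉ N → (Finsupp.linearCombination F (sbdry F) r) τ = 0) →
    (∀ σ ∈ E, ∃ τ ∈ σ.powersetCard d, τ ∉ N) →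
    (∀ q, Circ R q → q.support ⊆ E → q.support.card ≤ k) →
    4 * N.card + (d + 1) * (k * (k + 1)) ≤ (d + 1) * (c * (c + 1)) →
    ∃ J ⊆ E, (∀ r ∈ R, r.support ⊆ J → r = 0) ∧
      2 * E.card ≤ (d + 1) * (c * (c + 1)) * J.card := by
  classical
  induction n using Nat.strong_induction_on with
  | _ n ih =>
  intro E N R k hn hE h1 h2 h3 h4
  -- no circuits
  by_cases hcirc : ∀ q, Circ R q → ¬ q.support ⊆ E
  · refine ⟨E, subset_rfl, ?_, ?_⟩
    · intro r hr hrE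
      by_contra h0
      obtain ⟨f, hf⟩ := Finsupp.support_nonempty_iff.mpr h0
      obtain ⟨q, hq, -, hqs⟩ := exists_circ' hr (Finsupp.mem_support_iff.mp hf)
      exact hcirc q hq (hqs.trans hrE)
    · apply Nat.mul_le_mul_right
      have hcc : 1 ≤ c * (c + 1) := Nat.mul_pos (by omega) (by omega)
      calc 2 = 2 * 1 := rfl
        _ ≤ (d + 1) * (c * (c + 1)) := Nat.mul_le_mul (by omega) hcc
  push Not at hcirc
  -- not connected
  by_cases hconn : Conn R E
  swap
  · unfold Conn at hconn
    push Not at hconn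
    obtain ⟨A, hAE, hA, hAne, hsplit⟩ := hconn
    have hssA : A ⊂ E := lt_of_le_of_ne hAE hAne
    have hssB : E \ A ⊂ E := Finset.sdiff_ssubset hAE hA
    obtain ⟨J1, hJ1, hi1, hb1⟩ := ih _ (hn ▸ Finset.card_lt_card hssA) A N R k rfl
      (fun σ hσ => hE σ (hAE hσ)) h1 (fun σ hσ => h2 σ (hAE hσ))
      (fun q hq hs => h3 q hq (hs.trans hAE)) h4
    obtain ⟨J2, hJ2, hi2, hb2⟩ := ih _ (hn ▸ Finset.card_lt_card hssB) (E \ A) N R k rfl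
      (fun σ hσ => hE σ (hssB.subset hσ)) h1 (fun σ hσ => h2 σ (hssB.subset hσ))
      (fun q hq hs => h3 q hq (hs.trans hssB.subset)) h4
    refine ⟨J1 ∪ J2, Finset.union_subset (hJ1.trans hAE) (hJ2.trans hssB.subset), ?_, ?_⟩
    · intro r hr hrs
      have hrA := hsplit r hr
        (hrs.trans (Finset.union_subset (hJ1.trans hAE) (hJ2.trans hssB.subset)))
      have e1 : r.filter (· ∈ A) = 0 := by
        refine hi1 _ hrA ?_
        intro i hi
        rw [Finsupp.support_filter, Finset.mem_filter] at hi
        rcases Finset.mem_union.mp (hrs hi.1) with h | h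
        · exact h
        · exact absurd hi.2 (Finset.mem_sdiff.mp (hJ2 h)).2
      refine hi2 r hr ?_
      intro i hi
      rcases Finset.mem_union.mp (hrs hi) with h | h
      · have := DFunLike.congr_fun e1 i
        rw [Finsupp.filter_apply, if_pos (hJ1 h)] at this
        exact absurd this (Finsupp.mem_support_iff.mp hi)
      · exact h
    · rw [Finset.card_union_of_disjoint (Finset.disjoint_of_subset_left hJ1
        (Finset.disjoint_of_subset_right hJ2 Finset.disjoint_sdiff))]
      have := Finset.card_sdiff_add_card_eq_card hAE
      rw [mul_add]; omega
  -- connected: take a largest circuit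
  obtain ⟨x, hx, hxE, hmax⟩ : ∃ x, Circ R x ∧ x.support ⊆ E ∧
      ∀ q, Circ R q → q.support ⊆ E → q.support.card ≤ x.support.card := by
    let P : ℕ → Prop := fun m => ∃ q, Circ R q ∧ q.support ⊆ E ∧ q.support.card = m
    obtain ⟨q₀, hq₀, hq₀E⟩ := hcirc
    have hP : P (Nat.findGreatest P k) :=
      Nat.findGreatest_spec (h3 q₀ hq₀ hq₀E) ⟨q₀, hq₀, hq₀E, rfl⟩
    obtain ⟨x, hx, hxE, hxc⟩ := hP
    refine ⟨x, hx, hxE, fun q hq hqE => ?_⟩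
    rw [hxc]
    exact Nat.le_findGreatest (h3 q hq hqE) ⟨q, hq, hqE, rfl⟩
  set m := x.support.card with hm
  have hmk : m ≤ k := h3 x hx hxE
  have hxd : ∀ σ ∈ x.support, σ.card = d + 1 := fun σ hσ => hE σ (hxE hσ)
  have hm2 : 2 ≤ m := by
    obtain ⟨f, hf⟩ := Finsupp.support_nonempty_iff.mpr hx.2.1
    obtain ⟨τ, hτ, hτN⟩ := h2 f (hxE hf)
    exact (two_le_deg hxd (h1 x hx.1 τ hτN) hf hτ).trans (Finset.card_filter_le _ _)
  set G := x.support.biUnion fun σ => σ.powersetCard d with hG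
  set N' := N ∪ G with hN'
  have hnew : 2 * (G \ N).card ≤ (d + 1) * m :=
    new_faces hxd _ Finset.sdiff_subset
      (fun τ hτ => h1 x hx.1 τ (Finset.mem_sdiff.mp hτ).2)
  have hN'c : N'.card = N.card + (G \ N).card := by
    rw [hN', ← Finset.union_sdiff_self_eq_union,
      Finset.card_union_of_disjoint Finset.disjoint_sdiff]
  set D := E.filter (fun σ => σ.powersetCard d ⊆ N') with hD
  have hxD : x.support ⊆ D := by
    intro σ hσ
    rw [hD, Finset.mem_filter]
    refine ⟨hxE hσ, ?_⟩
    refine subset_trans ?_ Finset.subset_union_right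
    exact Finset.subset_biUnion_of_mem (fun σ : Finset V => σ.powersetCard d) hσ
  have hDE : D ⊆ E := Finset.filter_subset _ _
  -- number of removed simplices
  have hrem : d * D.card ≤ (G \ N).card * N'.card := by
    have hDsub : D ⊆ (G \ N).biUnion (fun τ => D.filter (fun σ => τ ∈ σ.powersetCard d)) := by
      intro σ hσ
      have hσ' := Finset.mem_filter.mp hσ
      obtain ⟨τ, hτ, hτN⟩ := h2 σ hσ'.1
      rw [Finset.mem_biUnion]
      refine ⟨τ, ?_, Finset.mem_filter.mpr ⟨hσ, hτ⟩⟩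
      rw [Finset.mem_sdiff]
      exact ⟨(Finset.mem_union.mp (hσ'.2 hτ)).resolve_left hτN, hτN⟩
    calc d * D.card ≤ d * ∑ τ ∈ G \ N, (D.filter (fun σ => τ ∈ σ.powersetCard d)).card :=
          Nat.mul_le_mul_left _ ((Finset.card_le_card hDsub).trans Finset.card_biUnion_le)
      _ = ∑ τ ∈ G \ N, d * (D.filter (fun σ => τ ∈ σ.powersetCard d)).card := by
          rw [Finset.mul_sum]
      _ ≤ ∑ τ ∈ G \ N, N'.card := by
          refine Finset.sum_le_sum (fun τ _ => deg_bound _ _ τ ?_)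
          intro σ hσ
          have hσ1 := Finset.mem_filter.mp hσ
          have hσ2 := Finset.mem_filter.mp hσ1.1
          exact ⟨hE σ hσ2.1, hσ1.2, hσ2.2⟩
      _ = (G \ N).card * N'.card := by simp
  have hxne : x.support.Nonempty := Finsupp.support_nonempty_iff.mpr hx.2.1
  have hss : E \ D ⊂ E := Finset.sdiff_ssubset hDE (hxne.mono hxD)
  clear_value m
  obtain ⟨m', rfl⟩ : ∃ m', m = m' + 1 := ⟨m - 1, by omega⟩
  have hmm : (m' + 1) * (m' + 2) ≤ k * (k + 1) := Nat.mul_le_mul hmk (by omega)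
  have hmm' : (d + 1) * ((m' + 1) * (m' + 2)) ≤ (d + 1) * (k * (k + 1)) :=
    Nat.mul_le_mul_left _ hmm
  have h4' : 4 * N'.card + (d + 1) * (m' * (m' + 1)) ≤ (d + 1) * (c * (c + 1)) := by
    rw [hN'c]; nlinarith
  obtain ⟨J, hJ, hJi, hJb⟩ := ih _ (hn ▸ Finset.card_lt_card hss) (E \ D) N'
    (R ⊔ Finsupp.supported F F (x.support : Set (Finset V))) m' rfl
    (fun σ hσ => hE σ (hss.subset hσ))
    (by
      intro r hr τ hτ
      obtain ⟨a, ha, b, hb, rfl⟩ := Submodule.mem_sup.mp hr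
      rw [hN', Finset.mem_union, not_or] at hτ
      rw [map_add, Finsupp.add_apply, h1 a ha τ hτ.1, zero_add, lc_apply]
      refine Finset.sum_eq_zero (fun σ hσ => ?_)
      rw [Finsupp.mem_supported] at hb
      have hσx : σ ∈ x.support := hb hσ
      have : sbdry F σ τ = 0 := by
        by_contra h
        exact hτ.2 (Finset.mem_biUnion.mpr ⟨σ, hσx, (sbdry_apply_ne (hxd σ hσx) τ).mp h⟩)
      rw [this, mul_zero])
    (by
      intro σ hσ
      rw [Finset.mem_sdiff, hD, Finset.mem_filter, not_and] at hσ
      exact Finset.not_subset.mp (hσ.2 hσ.1))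
    (by
      intro q hq hqs
      have := contract_lt hconn hx hxE (by rw [← hm]; exact hmax) hq (hqs.trans hss.subset) (by
        intro i hi
        by_contra hxi
        exact (Finset.mem_sdiff.mp (hqs (Finsupp.mem_support_iff.mpr hi))).2
          (hxD (Finsupp.mem_support_iff.mpr hxi)))
      omega)
    h4'
  obtain ⟨f, hf⟩ := hxne
  have hJx : Disjoint J (x.support.erase f) := by
    rw [Finset.disjoint_left]
    intro i hi hi'
    exact (Finset.mem_sdiff.mp (hJ hi)).2 (hxD (Finset.mem_of_mem_erase hi'))
  refine ⟨J ∪ x.support.erase f, Finset.union_subset (hJ.trans hss.subset)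
    ((Finset.erase_subset _ _).trans hxE), ?_, ?_⟩
  · intro r hr hrs
    have hz : r.filter (· ∈ J) = 0 := by
      refine hJi _ ?_ (by intro i hi; simp at hi; exact hi.2)
      have : r.filter (· ∈ J) = r - r.filter (fun i => ¬ i ∈ J) := by
        rw [eq_sub_iff_add_eq]; exact Finsupp.filter_add_filter_not r _
      rw [this]
      refine Submodule.sub_mem _ (Submodule.mem_sup_left hr) (Submodule.mem_sup_right ?_)
      rw [Finsupp.mem_supported]
      intro i hi
      rw [Finset.mem_coe, Finsupp.support_filter, Finset.mem_filter] at hi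
      exact Finset.mem_of_mem_erase ((Finset.mem_union.mp (hrs hi.1)).resolve_left hi.2)
    have hr' : r.support ⊆ x.support.erase f := by
      intro i hi
      refine (Finset.mem_union.mp (hrs hi)).resolve_left (fun h => ?_)
      have := DFunLike.congr_fun hz i
      rw [Finsupp.filter_apply, if_pos h] at this
      exact Finsupp.mem_support_iff.mp hi this
    refine hx.eq_zero hr (hr'.trans (Finset.erase_subset _ _)) (Finsupp.mem_support_iff.mp hf) ?_
    by_contra h
    simpa using hr' (Finsupp.mem_support_iff.mpr h)
  · rw [Finset.card_union_of_disjoint hJx, Finset.card_erase_of_mem hf, ← hm]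
    have e1 := Finset.card_sdiff_add_card_eq_card hDE
    -- removed bound
    have e2 : 2 * D.card ≤ (d + 1) * (c * (c + 1)) * m' := by
      set L := (d + 1) * (c * (c + 1)) with hL
      have a1 : 4 * N'.card ≤ L := by omega
      have a2 : (G \ N).card ≤ (d + 1) * m' := by nlinarith
      have a3 : (G \ N).card * (4 * N'.card) ≤ ((d + 1) * m') * L := Nat.mul_le_mul a2 a1
      have a4 : ((d + 1) * m') * L ≤ (2 * d * m') * L :=
        Nat.mul_le_mul_right _ (Nat.mul_le_mul_right _ (by omega))
      have a5 : d * (4 * D.card) ≤ d * (2 * (L * m')) := by nlinarith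
      have a6 := Nat.le_of_mul_le_mul_left a5 (by omega)
      omega
    rw [Nat.add_sub_cancel, mul_add]
    omega

lemma indep_card {d : ℕ} (K J : Finset (Finset V)) (hJK : J ⊆ K) (hK : ∀ σ ∈ K, σ.card = d + 1)
    (hJ : ∀ r ∈ LinearMap.ker (Finsupp.linearCombination F (sbdry F (V := V))),
      r.support ⊆ J → r = 0) :
    J.card ≤ (K.biUnion fun σ => σ.powersetCard d).card := by
  classical
  set T := K.biUnion fun σ => σ.powersetCard d with hT
  have hli : LinearIndepOn F (sbdry F (V := V)) (J : Set (Finset V)) := by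
    rw [linearIndepOn_iff]
    intro l hl h0
    exact hJ l h0 (by
      rw [Finsupp.mem_supported] at hl
      exact_mod_cast hl)
  have hspan : Set.range (fun i : (J : Set (Finset V)) => sbdry F (i : Finset V)) ≤
      Submodule.span F ((T.image (fun τ => Finsupp.single τ (1 : F)) : Finset _) :
        Set (Finset V →₀ F)) := by
    rintro _ ⟨⟨σ, hσ⟩, rfl⟩
    simp only [sbdry]
    refine Submodule.sum_mem _ (fun v hv => Submodule.smul_mem _ _ (Submodule.subset_span ?_))
    rw [Finset.mem_coe, Finset.mem_image]
    refine ⟨σ.erase v, ?_, rfl⟩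
    have hσK := hJK (Finset.mem_coe.mp hσ)
    rw [hT, Finset.mem_biUnion]
    refine ⟨σ, hσK, Finset.mem_powersetCard.mpr ⟨Finset.erase_subset _ _, ?_⟩⟩
    rw [Finset.card_erase_of_mem hv, hK σ hσK]; rfl
  have := linearIndependent_le_span' _ hli _ hspan
  simp only [Cardinal.mk_coe_finset, Finset.coe_sort_coe, Fintype.card_coe] at this
  have h2 : J.card ≤ (T.image (fun τ => Finsupp.single τ (1 : F))).card := by
    exact_mod_cast this
  exact h2.trans Finset.card_image_le

end complexes

/-- Let `d ≥ 1` and let `K` be a finite pure simplicial `d`-complex (given by its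
finite set of `d`-simplices; by purity its `(d-1)`-simplices are exactly the
`d`-element subsets of its `d`-simplices) whose `d`-simplices support a nontrivial
`d`-cycle over a field `F`.  Then `c_d(K) ≥ sqrt((2/(d+1)) · f_d(K)/f_{d-1}(K)) - 1`:
`K` has a simple `d`-cycle of size at least this bound. -/
theorem cMax_ge_sqrt_density (F : Type) [Field F] {V : Type} [LinearOrder V]
    (d : ℕ) (hd : 1 ≤ d) (K : Finset (Finset V)) (hK : ∀ σ ∈ K, σ.card = d + 1)
    (hcyc : ∃ c : (Finset V) →₀ F, IsCycle F d c ∧ c ≠ 0 ∧ c.support ⊆ K) :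
    ∃ c : (Finset V) →₀ F, IsSimpleCycle F d c ∧ c.support ⊆ K ∧
      Real.sqrt ((2 / ((d : ℝ) + 1)) *
          ((K.card : ℝ) / ((K.biUnion fun σ => σ.powersetCard d).card : ℝ))) - 1 ≤
        (c.support.card : ℝ) := by
  classical
  set R := LinearMap.ker (Finsupp.linearCombination F (sbdry F (V := V))) with hR
  have hcyc_iff : ∀ c : Finset V →₀ F, c.support ⊆ K → (IsCycle F d c ↔ c ∈ R) := by
    intro c hc
    rw [hR, LinearMap.mem_ker, Finsupp.linearCombination_apply]
    exact ⟨fun h => h.2, fun h => ⟨fun σ hσ => hK σ (hc hσ), h⟩⟩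
  have hsimple : ∀ c, Circ R c → c.support ⊆ K → IsSimpleCycle F d c := by
    intro c hc hcK
    refine ⟨(hcyc_iff c hcK).mpr hc.1, hc.2.1, fun c' h1 h2 h3 => ?_⟩
    exact hc.2.2 c' ((hcyc_iff c' (h3.trans hcK)).mp h1) h2 h3
  obtain ⟨c₀, hc0, hne, hc0K⟩ := hcyc
  obtain ⟨f, hf⟩ := Finsupp.support_nonempty_iff.mpr hne
  obtain ⟨q₀, hq0, -, hq0s⟩ := exists_circ' ((hcyc_iff c₀ hc0K).mp hc0) (Finsupp.mem_support_iff.mp hf)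
  obtain ⟨x, hx, hxK, hmax⟩ : ∃ x, Circ R x ∧ x.support ⊆ K ∧
      ∀ q, Circ R q → q.support ⊆ K → q.support.card ≤ x.support.card := by
    let P : ℕ → Prop := fun m => ∃ q, Circ R q ∧ q.support ⊆ K ∧ q.support.card = m
    have hP : P (Nat.findGreatest P K.card) :=
      Nat.findGreatest_spec (Finset.card_le_card (hq0s.trans hc0K)) ⟨q₀, hq0, hq0s.trans hc0K, rfl⟩
    obtain ⟨x, hx, hxE, hxc⟩ := hP
    refine ⟨x, hx, hxE, fun q hq hqE => ?_⟩
    rw [hxc]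
    exact Nat.le_findGreatest (Finset.card_le_card hqE) ⟨q, hq, hqE, rfl⟩
  refine ⟨x, hsimple x hx hxK, hxK, ?_⟩
  have hpos : 1 ≤ x.support.card := Finset.card_pos.mpr (Finsupp.support_nonempty_iff.mpr hx.2.1)
  obtain ⟨J, hJK, hJi, hJb⟩ := main_ind d hd x.support.card hpos _ K ∅ R x.support.card rfl hK
    (by
      intro r hr τ _
      rw [hR, LinearMap.mem_ker] at hr
      rw [hr]; rfl)
    (by
      intro σ hσ
      have : (σ.powersetCard d).Nonempty := Finset.powersetCard_nonempty.mpr (by rw [hK σ hσ]; omega)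
      obtain ⟨τ, hτ⟩ := this
      exact ⟨τ, hτ, by simp⟩)
    hmax (by simp)
  have hJc := indep_card K J hJK hK hJi
  set T := (K.biUnion fun σ => σ.powersetCard d).card with hT
  set m := x.support.card with hm
  have hfin : 2 * K.card ≤ (d + 1) * (m * (m + 1)) * T :=
    hJb.trans (Nat.mul_le_mul_left _ hJc)
  have hTpos : 0 < T := by
    rcases Nat.eq_zero_or_pos T with h | h
    · rw [h] at hfin
      have : 0 < K.card := Finset.card_pos.mpr ⟨f, hc0K hf⟩
      omega
    · exact h
  have hfin' : (2 : ℝ) * K.card ≤ ((d : ℝ) + 1) * (m * (m + 1)) * T := by exact_mod_cast hfin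
  have hTR : (0 : ℝ) < T := by exact_mod_cast hTpos
  have hdR : (0 : ℝ) < (d : ℝ) + 1 := by positivity
  rw [sub_le_iff_le_add]
  apply Real.sqrt_le_iff.mpr
  refine ⟨by positivity, ?_⟩
  rw [div_mul_div_comm, div_le_iff₀ (by positivity)]
  have : (0 : ℝ) ≤ ((d : ℝ) + 1) * T * (m + 1) := by positivity
  nlinarith
end
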